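/- arXiv:1709.01358 — 3 statements merged into one kernel-verified Lean document; each statement's English description precedes it below -/
import Mathlib

section
/- Let m ≥ 3 and let (W,S) be the Coxeter system of type I_2(m): S = {1,2} with m(1,2) = m. Then the homology of the weighted complex C_*(W) is: H_0 ≅ R/(Φ_2) = R/(q+1); H_1 ≅ ⊕_{d ≥ 2, d ∣ m} R/(Φ_d) (equivalently H_1 ≅ R/([m]_q) where [m]_q = 1+q+⋯+q^{m−1}); and H_k = 0 for all k ≥ 2. -/
open Polynomial CoxeterSystem

set_option synthInstance.maxHeartbeats 1000000
set_option maxHeartbeats 1000000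

noncomputable section

/-- The ring `R = ℚ[q,q⁻¹]` of Laurent polynomials over `ℚ`. -/
abbrev R : Type := LaurentPolynomial ℚ

/-- The image of the `d`-th cyclotomic polynomial `Φ_d` in `R`. -/
def cyc (d : ℕ) : R := Polynomial.toLaurent (Polynomial.cyclotomic d ℚ)

/-- The `R`-module `R/(Φ_d)`. -/
abbrev CycQuot (d : ℕ) := R ⧸ Ideal.span {cyc d}

variable {B : Type*} [Fintype B] [LinearOrder B] {W : Type*} [Group W]
  {M : CoxeterMatrix B} (cs : CoxeterSystem M W)

/-- The standard parabolic subgroup `W_σ` generated by `σ ⊆ S`. -/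
def parabolic (σ : Finset B) : Subgroup W := Subgroup.closure (cs.simple '' σ)

/-- The Poincaré polynomial `W_σ(q) = Σ_{w ∈ W_σ} q^{ℓ(w)}` of the standard parabolic
subgroup `W_σ` (defined to be `0` if `W_σ` is infinite). -/
def poin (σ : Finset B) : ℚ[X] :=
  letI := Classical.dec ((parabolic cs σ : Set W).Finite)
  if h : (parabolic cs σ : Set W).Finite then ∑ w ∈ h.toFinset, X ^ cs.length w else 0

/-- The set of simplices `σ ∈ K_W` with `|σ| = k`, i.e. the subsets of `S` of
cardinality `k` generating a finite standard parabolic subgroup. -/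
abbrev KW (k : ℕ) := {σ : Finset B // σ.card = k ∧ (parabolic cs σ : Set W).Finite}

noncomputable instance (k : ℕ) : Fintype (KW cs k) := Fintype.ofFinite _

/-- The coefficient of `e_τ` in `∂ e_σ`: it is
`(−1)^{#{t ∈ σ : t < s}} · W_σ(q)/W_{σ∖{s}}(q)` if `τ = σ ∖ {s}` for some `s ∈ σ`,
and `0` otherwise. -/
def bcoeff (σ τ : Finset B) : R :=
  ∑ s ∈ σ, if τ = σ.erase s then
      (-1 : R) ^ (σ.filter (fun t => t < s)).card *
        Polynomial.toLaurent (poin cs σ / poin cs τ)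
    else 0

/-- The boundary map `∂ : C_{k+1} → C_k` of the weighted complex `C_*(W)`, where
`C_k = ⊕_{σ ∈ K_W, |σ| = k} R·e_σ`. -/
def bdry (k : ℕ) : (KW cs (k + 1) → R) →ₗ[R] (KW cs k → R) :=
  Matrix.mulVecLin (Matrix.of fun (τ : KW cs k) (σ : KW cs (k + 1)) => bcoeff cs σ.1 τ.1)

/-- The submodule of cycles in degree `k` of the weighted complex. -/
def cycles : (k : ℕ) → Submodule R (KW cs k → R)
  | 0 => ⊤
  | (k + 1) => LinearMap.ker (bdry cs k)

/-- The `k`-th homology `H_k(C_*(W))` of the weighted complex: cycles modulo boundaries. -/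
abbrev Hgy (k : ℕ) :=
  cycles cs k ⧸ Submodule.comap (cycles cs k).subtype (LinearMap.range (bdry cs k))

end

namespace CoxeterSystem

variable {W : Type*} [Group W] {Mat : CoxeterMatrix (Fin 2)} (cs : CoxeterSystem Mat W)

/-- In rank two every element is the product of an alternating word of minimal length. -/
theorem exists_alternatingWord_length_eq (w : W) :
    w = cs.wordProd (alternatingWord 0 1 (cs.length w)) ∨
      w = cs.wordProd (alternatingWord 1 0 (cs.length w)) := by
  induction h : cs.length w generalizing w with
  | zero => left; simpa [alternatingWord] using cs.length_eq_zero_iff.mp h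
  | succ n ih =>
    have key : ∀ i j : Fin 2, cs.length (w * cs.simple j) = n →
        (w * cs.simple j = cs.wordProd (alternatingWord i j n) ∨
          w * cs.simple j = cs.wordProd (alternatingWord j i n)) →
        w = cs.wordProd (alternatingWord i j (n + 1)) := by
      rintro i j hl (hv | hv)
      · cases n with
        | zero =>
          rw [alternatingWord_succ, wordProd_concat]
          rw [alternatingWord] at hv ⊢
          rw [← hv, cs.simple_mul_simple_cancel_right]
        | succ k =>
          rw [alternatingWord_succ, wordProd_concat, mul_left_inj] at hv
          have := cs.length_wordProd_le (alternatingWord j i k)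
          rw [← hv, h, length_alternatingWord] at this
          omega
      · rw [alternatingWord_succ, wordProd_concat, ← hv, cs.simple_mul_simple_cancel_right]
    obtain ⟨j, hj⟩ := cs.exists_rightDescent_of_ne_one (w := w) (by rintro rfl; simp at h)
    rw [isRightDescent_iff, h, Nat.add_right_cancel_iff] at hj
    have hw := ih _ hj
    fin_cases j
    · exact Or.inr (key 1 0 hj hw.symm)
    · exact Or.inl (key 0 1 hj hw)

theorem length_le_of_rank_two (hm : Mat.M 0 1 ≠ 0) (w : W) : cs.length w ≤ Mat.M 0 1 := by
  by_contra! hlt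
  have key : ∀ i j : Fin 2, Mat.M i j = Mat.M 0 1 →
      w ≠ cs.wordProd (alternatingWord i j (cs.length w)) := by
    intro i j hij hw
    refine cs.not_isReduced_alternatingWord i j (m := cs.length w) (by rwa [hij])
      (by rwa [hij]) ?_
    rw [IsReduced, ← hw, length_alternatingWord]
  rcases cs.exists_alternatingWord_length_eq w with hw | hw
  · exact key 0 1 rfl hw
  · exact key 1 0 (Mat.symmetric 1 0) hw

/-- The alternating word of length `k` ending in `1`, followed by the letter `0` if `b`. -/
def alternatingProd (m : ℕ) (x : Fin m × Bool) : W :=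
  if x.2 then cs.wordProd (alternatingWord 1 0 (x.1 + 1))
  else cs.wordProd (alternatingWord 0 1 x.1)

theorem exists_alternatingProd_eq {m : ℕ} (hm : m ≠ 0) (h : Mat.M 0 1 = m) (w : W) :
    ∃ x : Fin m × Bool, cs.alternatingProd m x = w ∧ x.1 + x.2.toNat = cs.length w := by
  have hle := cs.length_le_of_rank_two (by rwa [h]) w
  rw [h] at hle
  have hcase : (cs.length w < m ∧ w = cs.wordProd (alternatingWord 0 1 (cs.length w))) ∨
      (0 < cs.length w ∧ w = cs.wordProd (alternatingWord 1 0 (cs.length w))) := by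
    rcases cs.exists_alternatingWord_length_eq w with hw | hw
    · rcases hle.lt_or_eq with hlt | heq
      · exact Or.inl ⟨hlt, hw⟩
      · refine Or.inr ⟨by omega, ?_⟩
        have hb := cs.wordProd_braidWord_eq 0 1
        have h' : Mat.M 1 0 = m := by rw [Mat.symmetric 1 0, h]
        rw [braidWord, braidWord, h, h'] at hb
        rw [heq, ← hb]
        rwa [heq] at hw
    · rcases Nat.eq_zero_or_pos (cs.length w) with h0 | h0
      · refine Or.inl ⟨by omega, ?_⟩
        rw [h0] at hw ⊢
        exact hw
      · exact Or.inr ⟨h0, hw⟩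
  rcases hcase with ⟨hlt, hw⟩ | ⟨h0, hw⟩
  · exact ⟨(⟨cs.length w, hlt⟩, false), by simp [alternatingProd, ← hw], by simp⟩
  · refine ⟨(⟨cs.length w - 1, by omega⟩, true), ?_, by simp; omega⟩
    simp only [alternatingProd, if_true]
    rw [Nat.sub_add_cancel h0, ← hw]

/-- A homomorphism onto the dihedral group sending the generators to `sr 0` and `sr 1`. -/
theorem exists_surjective_dihedralGroup (cs : CoxeterSystem Mat W) {m : ℕ} (h : Mat.M 0 1 = m) :
    ∃ f : W →* DihedralGroup m, Function.Surjective f := by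
  have hl : Mat.IsLiftable (fun i : Fin 2 => DihedralGroup.sr ((i : ℕ) : ZMod m)) := by
    intro i j
    have h' : Mat.M 1 0 = m := by rw [Mat.symmetric 1 0, h]
    fin_cases i <;> fin_cases j <;>
      simp [h, h', DihedralGroup.sr_mul_sr]
  refine ⟨cs.lift ⟨_, hl⟩, ?_⟩
  have h0 : cs.lift ⟨_, hl⟩ (cs.simple 0) = DihedralGroup.sr 0 := by
    rw [lift_apply_simple]; simp
  have h1 : cs.lift ⟨_, hl⟩ (cs.simple 1) = DihedralGroup.sr 1 := by
    rw [lift_apply_simple]; simp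
  have hr : ∀ k : ZMod m, ∃ w, cs.lift ⟨_, hl⟩ w = DihedralGroup.r k := by
    intro k
    obtain ⟨n, rfl⟩ := ZMod.intCast_surjective k
    refine ⟨(cs.simple 0 * cs.simple 1) ^ n, ?_⟩
    rw [map_zpow, map_mul, h0, h1, DihedralGroup.sr_mul_sr, sub_zero, DihedralGroup.r_one_zpow]
  rintro (k | k)
  · exact hr k
  · obtain ⟨w, hw⟩ := hr k
    exact ⟨cs.simple 0 * w, by rw [map_mul, h0, hw, DihedralGroup.sr_mul_r, zero_add]⟩

theorem alternatingProd_surjective {m : ℕ} (hm : m ≠ 0) (h : Mat.M 0 1 = m) :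
    Function.Surjective (cs.alternatingProd m) := fun w =>
  let ⟨x, hx, _⟩ := cs.exists_alternatingProd_eq hm h w
  ⟨x, hx⟩

theorem finite_of_rank_two (cs : CoxeterSystem Mat W) {m : ℕ} (hm : m ≠ 0)
    (h : Mat.M 0 1 = m) : Finite W :=
  Finite.of_surjective _ (cs.alternatingProd_surjective hm h)

theorem alternatingProd_bijective {m : ℕ} (hm : m ≠ 0) (h : Mat.M 0 1 = m) :
    Function.Bijective (cs.alternatingProd m) := by
  have := cs.finite_of_rank_two hm h
  obtain ⟨f, hf⟩ := cs.exists_surjective_dihedralGroup h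
  refine (cs.alternatingProd_surjective hm h).bijective_of_nat_card_le ?_
  have := Nat.card_le_card_of_surjective f hf
  rw [DihedralGroup.nat_card] at this
  simpa [mul_comm] using this

theorem length_alternatingProd {m : ℕ} (hm : m ≠ 0) (h : Mat.M 0 1 = m) (x : Fin m × Bool) :
    cs.length (cs.alternatingProd m x) = x.1 + x.2.toNat := by
  obtain ⟨y, hy, hl⟩ := cs.exists_alternatingProd_eq hm h (cs.alternatingProd m x)
  rw [← hl, (cs.alternatingProd_bijective hm h).1 hy]

end CoxeterSystem

section Poincare

variable {B : Type*} {W : Type*} [Group W]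
  {M : CoxeterMatrix B} (cs : CoxeterSystem M W)

theorem poin_eq_sum (σ : Finset B) (s : Finset W) (hs : (parabolic cs σ : Set W) = s) :
    poin cs σ = ∑ w ∈ s, X ^ cs.length w := by
  have h : (parabolic cs σ : Set W).Finite := hs ▸ s.finite_toSet
  rw [poin, dif_pos h]
  refine Finset.sum_congr ?_ fun _ _ => rfl
  ext w
  simp [hs]

theorem poin_empty : poin cs ∅ = 1 := by
  rw [poin_eq_sum cs ∅ {1} (by simp [parabolic])]
  simp

theorem coe_parabolic_singleton (i : B) :
    (parabolic cs {i} : Set W) = {1, cs.simple i} := by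
  ext w
  simp only [parabolic, Finset.coe_singleton, Set.image_singleton, SetLike.mem_coe,
    Set.mem_insert_iff, Set.mem_singleton_iff]
  constructor
  · intro hw
    induction hw using Subgroup.closure_induction with
    | mem x hx => exact Or.inr hx
    | one => exact Or.inl rfl
    | mul x y _ _ hx hy => rcases hx with rfl | rfl <;> rcases hy with rfl | rfl <;> simp
    | inv x _ hx => rcases hx with rfl | rfl <;> simp
  · rintro (rfl | rfl)
    · exact one_mem _
    · exact Subgroup.subset_closure rfl

theorem poin_singleton (i : B) : poin cs {i} = X + 1 := by
  classical
  have hne : (1 : W) ≠ cs.simple i := by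
    intro h
    simpa [← h] using cs.length_simple i
  rw [poin_eq_sum cs {i} {1, cs.simple i} (by simp [coe_parabolic_singleton]),
    Finset.sum_pair hne]
  simp [add_comm]

theorem poin_univ_rank_two {Mat : CoxeterMatrix (Fin 2)} (cs : CoxeterSystem Mat W) {m : ℕ}
    (hm : m ≠ 0) (h : Mat.M 0 1 = m) :
    poin cs Finset.univ = (X + 1) * ∑ j ∈ Finset.range m, X ^ j := by
  have := cs.finite_of_rank_two hm h
  have := Fintype.ofFinite W
  rw [poin_eq_sum cs Finset.univ Finset.univ (by
    simp [parabolic, cs.subgroup_closure_range_simple]),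
    ← (Equiv.ofBijective _ (cs.alternatingProd_bijective hm h)).sum_comp, Fintype.sum_prod_type]
  simp only [Equiv.ofBijective_apply, cs.length_alternatingProd hm h, Fintype.sum_bool]
  rw [Finset.mul_sum, ← Fin.sum_univ_eq_sum_range (fun j => ((X : ℚ[X]) + 1) * X ^ j)]
  refine Finset.sum_congr rfl fun k _ => ?_
  simp only [Bool.toNat_true, Bool.toNat_false]
  ring

end Poincare

section Homology

theorem isCoprime_cyc {d e : ℕ} (h : d ≠ e) : IsCoprime (cyc d) (cyc e) :=
  (Polynomial.cyclotomic.isCoprime_rat h).map Polynomial.toLaurent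

/-- The Chinese remainder theorem for `[m]_q = ∏_{d ∣ m, d ≥ 2} Φ_d`. -/
theorem nonempty_quotient_geom_sum_equiv_pi {m : ℕ} (hm : m ≠ 0) :
    Nonempty ((R ⧸ Ideal.span {Polynomial.toLaurent (∑ j ∈ Finset.range m, (X : ℚ[X]) ^ j)})
      ≃ₗ[R] ((d : {d : ℕ // 2 ≤ d ∧ d ∣ m}) → CycQuot d.1)) := by
  have hmem : ∀ d : ℕ, d ∈ m.divisors.erase 1 ↔ 2 ≤ d ∧ d ∣ m := by
    intro d
    rw [Finset.mem_erase, Nat.mem_divisors]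
    constructor
    · rintro ⟨h1, hd, -⟩
      have := Nat.pos_of_dvd_of_pos hd (Nat.pos_of_ne_zero hm)
      exact ⟨by omega, hd⟩
    · rintro ⟨h2, hd⟩
      exact ⟨by omega, hd, hm⟩
  have : Fintype {d : ℕ // 2 ≤ d ∧ d ∣ m} := Fintype.subtype _ hmem
  have hprod : ∏ d : {d : ℕ // 2 ≤ d ∧ d ∣ m}, cyc d.1 =
      Polynomial.toLaurent (∑ j ∈ Finset.range m, (X : ℚ[X]) ^ j) := by
    rw [← prod_cyclotomic_eq_geom_sum (Nat.pos_of_ne_zero hm), map_prod]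
    exact (Finset.prod_subtype _ hmem cyc).symm
  have hcop : Pairwise fun d e : {d : ℕ // 2 ≤ d ∧ d ∣ m} => IsCoprime (cyc d.1) (cyc e.1) :=
    fun d e h => isCoprime_cyc (Subtype.coe_ne_coe.mpr h)
  let f : R →ₗ[R] ((d : {d : ℕ // 2 ≤ d ∧ d ∣ m}) → CycQuot d.1) :=
    LinearMap.pi fun d => (Ideal.span {cyc d.1}).mkQ
  have hf : Function.Surjective f := by
    intro y
    obtain ⟨r, hr⟩ := Ideal.pi_quotient_surjective
      (I := fun d : {d : ℕ // 2 ≤ d ∧ d ∣ m} => Ideal.span {cyc d.1})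
      (fun d e h => (Ideal.isCoprime_span_singleton_iff _ _).mpr (hcop h)) y
    exact ⟨r, funext hr⟩
  have hker : Ideal.span {Polynomial.toLaurent (∑ j ∈ Finset.range m, (X : ℚ[X]) ^ j)} =
      LinearMap.ker f := by
    rw [LinearMap.ker_pi, ← hprod, ← Ideal.iInf_span_singleton hcop]
    simp only [Submodule.ker_mkQ]
  exact ⟨(Submodule.quotEquivOfEq _ _ hker).trans (f.quotKerEquivOfSurjective hf)⟩

variable {W : Type*} [Group W] {Mat : CoxeterMatrix (Fin 2)} (cs : CoxeterSystem Mat W)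

theorem bcoeff_singleton_empty (i : Fin 2) : bcoeff cs {i} ∅ = cyc 2 := by
  rw [bcoeff, Finset.sum_singleton, poin_singleton, poin_empty]
  simp [cyc, Finset.filter_singleton]

theorem bcoeff_univ_singleton_one {m : ℕ} (hm : m ≠ 0) (h : Mat.M 0 1 = m) :
    bcoeff cs Finset.univ {1} =
      Polynomial.toLaurent (∑ j ∈ Finset.range m, (X : ℚ[X]) ^ j) := by
  have hX : (X : ℚ[X]) + 1 ≠ 0 := X_add_C_ne_zero 1
  rw [bcoeff, Fin.sum_univ_two, if_pos (by decide), if_neg (by decide), poin_singleton,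
    poin_univ_rank_two cs hm h, mul_div_cancel_left₀ _ hX]
  simp

theorem bcoeff_univ_singleton_zero {m : ℕ} (hm : m ≠ 0) (h : Mat.M 0 1 = m) :
    bcoeff cs Finset.univ {0} =
      -Polynomial.toLaurent (∑ j ∈ Finset.range m, (X : ℚ[X]) ^ j) := by
  have hX : (X : ℚ[X]) + 1 ≠ 0 := X_add_C_ne_zero 1
  have hc : (Finset.univ.filter fun t : Fin 2 => t < 1).card = 1 := by decide
  rw [bcoeff, Fin.sum_univ_two, if_neg (by decide), if_pos (by decide), poin_singleton,
    poin_univ_rank_two cs hm h, mul_div_cancel_left₀ _ hX, hc]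
  simp

theorem bdry_apply (k : ℕ) (x : KW cs (k + 1) → R) (τ : KW cs k) :
    bdry cs k x τ = ∑ σ : KW cs (k + 1), bcoeff cs σ.1 τ.1 * x σ := by
  simp [bdry, Matrix.mulVec, dotProduct]

/-- The vertex `∅`. -/
def emptyKW : KW cs 0 := ⟨∅, rfl, by simp [parabolic]⟩

/-- The simplices of cardinality one. -/
def singletonKW (i : Fin 2) : KW cs 1 :=
  ⟨{i}, rfl, by rw [coe_parabolic_singleton]; exact Set.toFinite _⟩

/-- The top simplex of a finite Coxeter group of rank two. -/
def univKW [Finite W] : KW cs 2 := ⟨Finset.univ, rfl, Set.toFinite _⟩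

theorem eq_emptyKW (σ : KW cs 0) : σ = emptyKW cs :=
  Subtype.ext (Finset.card_eq_zero.mp σ.2.1)

theorem singletonKW_bijective : Function.Bijective (singletonKW cs) := by
  refine ⟨fun i j h => Finset.singleton_injective (congrArg Subtype.val h), fun σ => ?_⟩
  obtain ⟨i, hi⟩ := Finset.card_eq_one.mp σ.2.1
  exact ⟨i, Subtype.ext hi.symm⟩

theorem eq_univKW [Finite W] (σ : KW cs 2) : σ = univKW cs :=
  Subtype.ext (Finset.card_eq_iff_eq_univ _ |>.mp (by simpa using σ.2.1))

theorem bdry_zero_apply (x : KW cs 1 → R) (τ : KW cs 0) :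
    bdry cs 0 x τ = cyc 2 * (x (singletonKW cs 0) + x (singletonKW cs 1)) := by
  rw [eq_emptyKW cs τ, bdry_apply,
    ← (Equiv.ofBijective _ (singletonKW_bijective cs)).sum_comp, Fin.sum_univ_two]
  simp only [Equiv.ofBijective_apply, singletonKW, emptyKW, bcoeff_singleton_empty]
  ring

theorem bdry_one_apply [Finite W] (x : KW cs 2 → R) (τ : KW cs 1) :
    bdry cs 1 x τ = bcoeff cs Finset.univ τ.1 * x (univKW cs) := by
  rw [bdry_apply, Finset.sum_eq_single (univKW cs)
    (fun σ _ h => absurd (eq_univKW cs σ) h) (by simp)]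
  rfl

theorem cyc_ne_zero (d : ℕ) : cyc d ≠ 0 :=
  Polynomial.toLaurent_ne_zero.mpr (cyclotomic_ne_zero d ℚ)

theorem geom_sum_X_ne_zero {m : ℕ} (hm : m ≠ 0) : ∑ j ∈ Finset.range m, (X : ℚ[X]) ^ j ≠ 0 := by
  rw [← prod_cyclotomic_eq_geom_sum (Nat.pos_of_ne_zero hm)]
  exact Finset.prod_ne_zero_iff.mpr fun d _ => cyclotomic_ne_zero d ℚ

theorem nonempty_homology_zero_equiv : Nonempty (Hgy cs 0 ≃ₗ[R] CycQuot 2) := by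
  let f : cycles cs 0 →ₗ[R] CycQuot 2 :=
    (Ideal.span {cyc 2}).mkQ ∘ₗ LinearMap.proj (emptyKW cs) ∘ₗ (cycles cs 0).subtype
  have hf : Function.Surjective f := by
    intro y
    obtain ⟨r, rfl⟩ := Submodule.mkQ_surjective _ y
    exact ⟨⟨fun _ => r, trivial⟩, rfl⟩
  have hker : Submodule.comap (cycles cs 0).subtype (LinearMap.range (bdry cs 0)) =
      LinearMap.ker f := by
    ext ⟨x, hx⟩
    simp only [f, Submodule.mem_comap, Submodule.subtype_apply, LinearMap.mem_range,
      LinearMap.mem_ker, LinearMap.comp_apply, LinearMap.proj_apply, Submodule.mkQ_apply,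
      Submodule.Quotient.mk_eq_zero, Ideal.mem_span_singleton]
    constructor
    · rintro ⟨y, rfl⟩
      exact ⟨_, bdry_zero_apply cs y _⟩
    · rintro ⟨r, hr⟩
      classical
      refine ⟨Pi.single (singletonKW cs 0) r, funext fun τ => ?_⟩
      have hne : singletonKW cs 1 ≠ singletonKW cs 0 :=
        (singletonKW_bijective cs).1.ne (by decide)
      rw [bdry_zero_apply, Pi.single_eq_same, Pi.single_eq_of_ne hne, add_zero, ← hr,
        eq_emptyKW cs τ]
  exact ⟨(Submodule.quotEquivOfEq _ _ hker).trans (f.quotKerEquivOfSurjective hf)⟩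

theorem mem_cycles_one (x : KW cs 1 → R) :
    x ∈ cycles cs 1 ↔ x (singletonKW cs 0) = -x (singletonKW cs 1) := by
  rw [cycles, LinearMap.mem_ker, ← add_eq_zero_iff_eq_neg, funext_iff]
  constructor
  · intro h
    have := h (emptyKW cs)
    rw [bdry_zero_apply] at this
    exact (mul_eq_zero.mp this).resolve_left (cyc_ne_zero 2)
  · intro h τ
    rw [bdry_zero_apply, h, mul_zero]
    rfl

theorem nonempty_homology_one_equiv {m : ℕ} (hm : m ≠ 0) (h : Mat.M 0 1 = m) :
    Nonempty (Hgy cs 1 ≃ₗ[R]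
      (R ⧸ Ideal.span {Polynomial.toLaurent (∑ j ∈ Finset.range m, (X : ℚ[X]) ^ j)})) := by
  have := cs.finite_of_rank_two hm h
  have hne : singletonKW cs 0 ≠ singletonKW cs 1 :=
    (singletonKW_bijective cs).1.ne (by decide)
  have hb1 := bcoeff_univ_singleton_one cs hm h
  have hb0 := bcoeff_univ_singleton_zero cs hm h
  generalize Polynomial.toLaurent (∑ j ∈ Finset.range m, (X : ℚ[X]) ^ j) = p at hb0 hb1 ⊢
  let f : cycles cs 1 →ₗ[R] (R ⧸ Ideal.span {p}) :=
    (Ideal.span {p}).mkQ ∘ₗ LinearMap.proj (singletonKW cs 1) ∘ₗ (cycles cs 1).subtype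
  have hf : Function.Surjective f := by
    classical
    intro y
    obtain ⟨r, rfl⟩ := Submodule.mkQ_surjective _ y
    refine ⟨⟨fun τ => if τ = singletonKW cs 1 then r else -r, ?_⟩, ?_⟩
    · rw [mem_cycles_one, if_neg hne, if_pos rfl]
    · simp [f]
  have hker : Submodule.comap (cycles cs 1).subtype (LinearMap.range (bdry cs 1)) =
      LinearMap.ker f := by
    ext ⟨x, hx⟩
    rw [mem_cycles_one] at hx
    simp only [f, Submodule.mem_comap, Submodule.subtype_apply, LinearMap.mem_range,
      LinearMap.mem_ker, LinearMap.comp_apply, LinearMap.proj_apply, Submodule.mkQ_apply,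
      Submodule.Quotient.mk_eq_zero, Ideal.mem_span_singleton]
    constructor
    · rintro ⟨y, rfl⟩
      rw [bdry_one_apply, singletonKW, hb1]
      exact ⟨_, rfl⟩
    · rintro ⟨r, hr⟩
      refine ⟨fun _ => r, funext fun τ => ?_⟩
      obtain ⟨i, rfl⟩ := (singletonKW_bijective cs).2 τ
      rw [bdry_one_apply]
      match i with
      | 0 => rw [hx, hr, ← neg_mul, ← hb0, singletonKW]
      | 1 => rw [hr, ← hb1, singletonKW]
  exact ⟨(Submodule.quotEquivOfEq _ _ hker).trans (f.quotKerEquivOfSurjective hf)⟩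

theorem cycles_two_eq_bot {m : ℕ} (hm : m ≠ 0) (h : Mat.M 0 1 = m) : cycles cs 2 = ⊥ := by
  have := cs.finite_of_rank_two hm h
  refine LinearMap.ker_eq_bot'.mpr fun x hx => funext fun σ => ?_
  have h1 := congrFun hx (singletonKW cs 1)
  rw [bdry_one_apply] at h1
  rw [eq_univKW cs σ]
  refine (mul_eq_zero.mp h1).resolve_left ?_
  rw [singletonKW, bcoeff_univ_singleton_one cs hm h]
  exact Polynomial.toLaurent_ne_zero.mpr (geom_sum_X_ne_zero hm)

theorem subsingleton_cycles {m : ℕ} (hm : m ≠ 0) (h : Mat.M 0 1 = m) {k : ℕ} (hk : 2 ≤ k) :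
    Subsingleton (cycles cs k) := by
  rcases hk.eq_or_lt with rfl | hk
  · rw [cycles_two_eq_bot cs hm h]
    infer_instance
  · have : IsEmpty (KW cs k) := by
      refine ⟨fun σ => ?_⟩
      have := Finset.card_le_univ σ.1
      rw [σ.2.1, Fintype.card_fin] at this
      omega
    infer_instance

end Homology

/-- Homology of the weighted complex for the Coxeter system of type `I₂(m)`, `m ≥ 3`:
`H₀ ≅ R/(Φ₂)`, `H₁ ≅ ⊕_{d ≥ 2, d ∣ m} R/(Φ_d)` (equivalently `R/([m]_q)`), and `H_k = 0`
for `k ≥ 2`. -/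
theorem homology_I2 (m : ℕ) (hm : 3 ≤ m) {W : Type*} [Group W]
    {Mat : CoxeterMatrix (Fin 2)} (cs : CoxeterSystem Mat W)
    (h12 : Mat.M 0 1 = m) :
    Nonempty (Hgy cs 0 ≃ₗ[R] CycQuot 2) ∧
    Nonempty (Hgy cs 1 ≃ₗ[R] ((d : {d : ℕ // 2 ≤ d ∧ d ∣ m}) → CycQuot d.1)) ∧
    Nonempty (Hgy cs 1 ≃ₗ[R]
      (R ⧸ Ideal.span {Polynomial.toLaurent (∑ j ∈ Finset.range m, (X : ℚ[X]) ^ j)})) ∧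
    (∀ k, 2 ≤ k → Subsingleton (Hgy cs k)) := by
  have h0 : m ≠ 0 := by omega
  obtain ⟨e⟩ := nonempty_homology_one_equiv cs h0 h12
  obtain ⟨e'⟩ := nonempty_quotient_geom_sum_equiv_pi h0
  refine ⟨nonempty_homology_zero_equiv cs, ⟨e.trans e'⟩, ⟨e⟩, fun k hk => ?_⟩
  have := subsingleton_cycles cs h0 h12 hk
  infer_instance
end

section
/- Let (W,S) be the Coxeter system of type H_3: S = {1,2,3} with m(1,2) = 5, m(2,3) = 3, m(1,3) = 2. Then the homology of the weighted complex C_*(W) is: H_0 ≅ R/(Φ_2); H_1 = 0; H_2 ≅ R/(Φ_2) ⊕ R/(Φ_6) ⊕ R/(Φ_10); and H_k = 0 for all k ≥ 3. -/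
open Polynomial CoxeterSystem

set_option synthInstance.maxHeartbeats 1000000
set_option maxHeartbeats 1000000

namespace H3

/-- States indexing the elements of the Coxeter group of type `H₃`: a minimal representative of a
left coset of the dihedral subgroup generated by the first two generators, and an element of that
subgroup. -/
abbrev State := Fin 12 × Fin 10

/-- Reduced words of the minimal left coset representatives. -/
def cosetWord : Fin 12 → List (Fin 3) :=
  ![[], [2], [1, 2], [0, 1, 2], [1, 0, 1, 2], [0, 1, 0, 1, 2], [2, 1, 0, 1, 2],
    [0, 2, 1, 0, 1, 2], [1, 0, 2, 1, 0, 1, 2], [0, 1, 0, 2, 1, 0, 1, 2],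
    [1, 0, 1, 0, 2, 1, 0, 1, 2], [2, 1, 0, 1, 0, 2, 1, 0, 1, 2]]

/-- Reduced words of the elements of the dihedral subgroup. -/
def dihedralWord : Fin 10 → List (Fin 3) :=
  ![[], [0], [1], [1, 0], [0, 1], [0, 1, 0], [1, 0, 1], [1, 0, 1, 0], [0, 1, 0, 1],
    [0, 1, 0, 1, 0]]

/-- The reduced word attached to a state. -/
def word (p : State) : List (Fin 3) := cosetWord p.1 ++ dihedralWord p.2

/-- Left multiplication of a coset representative `x` by a generator `s`: either `s x` is another
representative, or `s x = x t` for a generator `t` of the dihedral subgroup. -/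
def cosetStep : Fin 3 → Fin 12 → Fin 12 ⊕ Fin 2 :=
  ![![.inr 0, .inr 0, .inl 3, .inl 2, .inl 5, .inl 4, .inl 7, .inl 6, .inl 9, .inl 8, .inr 1,
      .inr 1],
    ![.inr 1, .inl 2, .inl 1, .inl 4, .inl 3, .inr 0, .inr 1, .inl 8, .inl 7, .inl 10, .inl 9,
      .inr 0],
    ![.inl 1, .inl 0, .inr 1, .inr 1, .inl 6, .inl 7, .inl 4, .inl 5, .inr 0, .inr 0, .inl 11,
      .inl 10]]

/-- Left multiplication in the dihedral subgroup. -/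
def dihedralStep : Fin 2 → Fin 10 → Fin 10 :=
  ![![1, 0, 4, 5, 2, 3, 8, 9, 6, 7], ![2, 3, 0, 1, 6, 7, 4, 5, 9, 8]]

/-- Left multiplication by a generator on states. -/
def act (s : Fin 3) (p : State) : State :=
  match cosetStep s p.1 with
  | .inl i => (i, p.2)
  | .inr t => (p.1, dihedralStep t p.2)

/-- The state reached from the identity by applying a word. -/
def run (ω : List (Fin 3)) : State := ω.foldr act (0, 0)

theorem run_word : ∀ p : State, run (word p) = p := by decide +kernel

theorem length_word_act : ∀ (s : Fin 3) (p : State),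
    (word (act s p)).length ≤ (word p).length + 1 := by decide +kernel

theorem mem_word_act : ∀ (s : Fin 3) (p : State), ∀ a ∈ word (act s p), a = s ∨ a ∈ word p := by
  decide +kernel

theorem length_word_lt : ∀ p : State, (word p).length < 16 := by decide +kernel

theorem act_act : ∀ (s : Fin 3) (p : State), act s (act s p) = p := by decide +kernel

theorem act_iterate_zero_one : ∀ p : State, (act 0 ∘ act 1)^[5] p = p := by decide +kernel

theorem act_iterate_one_zero : ∀ p : State, (act 1 ∘ act 0)^[5] p = p := by decide +kernel

theorem act_iterate_one_two : ∀ p : State, (act 1 ∘ act 2)^[3] p = p := by decide +kernel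

theorem act_iterate_two_one : ∀ p : State, (act 2 ∘ act 1)^[3] p = p := by decide +kernel

theorem act_iterate_zero_two : ∀ p : State, (act 0 ∘ act 2)^[2] p = p := by decide +kernel

theorem act_iterate_two_zero : ∀ p : State, (act 2 ∘ act 0)^[2] p = p := by decide +kernel

theorem length_run_le (ω : List (Fin 3)) : (word (run ω)).length ≤ ω.length := by
  induction ω with
  | nil => decide
  | cons s ω ih => exact (length_word_act s (run ω)).trans (by simpa using ih)

theorem mem_word_run (ω : List (Fin 3)) : ∀ a ∈ word (run ω), a ∈ ω := by
  induction ω with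
  | nil => decide
  | cons s ω ih =>
    intro a ha
    rcases mem_word_act s (run ω) a ha with h | h
    · simp [h]
    · simp [ih a h]

/-- The action of a generator on states, as an element of the monoid of self-maps. -/
def actEnd (s : Fin 3) : Function.End State := act s

theorem isLiftable_act {Mat : CoxeterMatrix (Fin 3)}
    (h12 : Mat.M 0 1 = 5) (h23 : Mat.M 1 2 = 3) (h13 : Mat.M 0 2 = 2) :
    Mat.IsLiftable actEnd := by
  have h21 := (Mat.symmetric 1 0).trans h12
  have h32 := (Mat.symmetric 2 1).trans h23
  have h31 := (Mat.symmetric 2 0).trans h13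
  have key (s t : Fin 3) (n : ℕ) (hn : Mat.M s t = n)
      (h : ∀ p : State, (act s ∘ act t)^[n] p = p) :
      (actEnd s * actEnd t) ^ Mat.M s t = 1 := by
    rw [hn]
    funext p
    exact (congrFun (smul_iterate (actEnd s * actEnd t) n) p).symm.trans (h p)
  intro s t
  fin_cases s <;> fin_cases t
  · exact key 0 0 1 (Mat.diagonal 0) (act_act 0)
  · exact key 0 1 5 h12 act_iterate_zero_one
  · exact key 0 2 2 h13 act_iterate_zero_two
  · exact key 1 0 5 h21 act_iterate_one_zero
  · exact key 1 1 1 (Mat.diagonal 1) (act_act 1)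
  · exact key 1 2 3 h23 act_iterate_one_two
  · exact key 2 0 2 h31 act_iterate_two_zero
  · exact key 2 1 3 h32 act_iterate_two_one
  · exact key 2 2 1 (Mat.diagonal 2) (act_act 2)

/-- Rewriting rules for products of elements satisfying the braid relations of type `H₃`. -/
theorem braid_consequences {G : Type*} [Semigroup G] {a b c : G}
    (hac : c * a = a * c)
    (hbc : c * (b * c) = b * (c * b)) (hab : b * (a * (b * (a * b))) = a * (b * (a * (b * a)))) :
    c * (b * (a * c)) = b * (c * (b * a)) ∧
    c * (b * (a * (b * (c * b)))) = b * (c * (b * (a * (b * c)))) ∧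
    c * (b * (a * (b * (a * (c * (b * (a * (b * a)))))))) =
      b * (c * (b * (a * (b * (a * (c * (b * (a * b)))))))) := by
  have tail {x y : G} (h : x = y) (z : G) : x * z = y * z := by rw [h]
  have hac' := tail hac
  have hbc' := tail hbc
  have hab' := tail hab
  simp only [mul_assoc] at hac' hbc' hab'
  have h1 : c * (b * (a * c)) = b * (c * (b * a)) := by
    rw [← hac, hbc']
  have h1' := tail h1
  simp only [mul_assoc] at h1'
  have h2 : c * (b * (a * (b * (c * b)))) = b * (c * (b * (a * (b * c)))) := by
    rw [← hbc, h1']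
  have h2' := tail h2
  simp only [mul_assoc] at h2'
  refine ⟨h1, h2, ?_⟩
  rw [← hac', ← hab, h2', hac']

section Group

variable {W : Type*} [Group W] {Mat : CoxeterMatrix (Fin 3)} (cs : CoxeterSystem Mat W)

theorem simple_two_zero (h13 : Mat.M 0 2 = 2) :
    cs.simple 2 * cs.simple 0 = cs.simple 0 * cs.simple 2 := by
  have h := cs.simple_mul_simple_pow 0 2
  rw [h13, pow_two] at h
  simpa [mul_assoc] using (eq_inv_of_mul_eq_one_right h).symm

theorem simple_two_one_two (h23 : Mat.M 1 2 = 3) :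
    cs.simple 2 * (cs.simple 1 * cs.simple 2) = cs.simple 1 * (cs.simple 2 * cs.simple 1) := by
  have h := cs.simple_mul_simple_pow 1 2
  rw [h23] at h
  have h' : cs.simple 1 * (cs.simple 2 * cs.simple 1) *
      (cs.simple 2 * (cs.simple 1 * cs.simple 2)) = 1 := by
    simpa only [pow_succ, pow_zero, one_mul, mul_assoc] using h
  simpa [mul_assoc] using eq_inv_of_mul_eq_one_right h'

theorem simple_one_zero_one_zero_one (h12 : Mat.M 0 1 = 5) :
    cs.simple 1 * (cs.simple 0 * (cs.simple 1 * (cs.simple 0 * cs.simple 1))) =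
      cs.simple 0 * (cs.simple 1 * (cs.simple 0 * (cs.simple 1 * cs.simple 0))) := by
  have h := cs.simple_mul_simple_pow 0 1
  rw [h12] at h
  have h' : cs.simple 0 * (cs.simple 1 * (cs.simple 0 * (cs.simple 1 * cs.simple 0))) *
      (cs.simple 1 * (cs.simple 0 * (cs.simple 1 * (cs.simple 0 * cs.simple 1)))) = 1 := by
    simpa only [pow_succ, pow_zero, one_mul, mul_assoc] using h
  simpa [mul_assoc] using eq_inv_of_mul_eq_one_right h'

/-- Left multiplication of the coset representatives by generators is described by
`cosetStep`. -/
theorem simple_mul_cosetWord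
    (h12 : Mat.M 0 1 = 5) (h23 : Mat.M 1 2 = 3) (h13 : Mat.M 0 2 = 2) (s : Fin 3) (i : Fin 12) :
    cs.simple s * cs.wordProd (cosetWord i) =
      match cosetStep s i with
      | .inl j => cs.wordProd (cosetWord j)
      | .inr t => cs.wordProd (cosetWord i) * cs.simple t.castSucc := by
  have tail {x y : W} (h : x = y) (z : W) : x * z = y * z := by rw [h]
  have hac := simple_two_zero cs h13
  have hbc := simple_two_one_two cs h23
  have hab := simple_one_zero_one_zero_one cs h12
  obtain ⟨h1, h2, h3⟩ := braid_consequences hac hbc hab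
  have hac' := tail hac
  have hab' := tail hab
  have h1' := tail h1
  have h3' := tail h3
  simp only [mul_assoc] at hac' hab' h1' h3'
  fin_cases s <;> fin_cases i <;>
    simp [cosetWord, cosetStep, wordProd_cons, mul_assoc, hac, hac', hbc, hab', h1', h2, h3']

theorem simple_mul_dihedralWord (h12 : Mat.M 0 1 = 5) (t : Fin 2) (j : Fin 10) :
    cs.simple t.castSucc * cs.wordProd (dihedralWord j) =
      cs.wordProd (dihedralWord (dihedralStep t j)) := by
  have hab := simple_one_zero_one_zero_one cs h12
  have hab' (z : W) : cs.simple 1 * (cs.simple 0 * (cs.simple 1 * (cs.simple 0 *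
      (cs.simple 1 * z)))) = cs.simple 0 * (cs.simple 1 * (cs.simple 0 * (cs.simple 1 *
      (cs.simple 0 * z)))) := by
    simpa only [mul_assoc] using congrArg (· * z) hab
  fin_cases t <;> fin_cases j <;>
    simp [dihedralWord, dihedralStep, wordProd_cons, hab, hab']

theorem simple_mul_word
    (h12 : Mat.M 0 1 = 5) (h23 : Mat.M 1 2 = 3) (h13 : Mat.M 0 2 = 2) (s : Fin 3) (p : State) :
    cs.simple s * cs.wordProd (word p) = cs.wordProd (word (act s p)) := by
  have h := simple_mul_cosetWord cs h12 h23 h13 s p.1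
  simp only [word, act, wordProd_append]
  rw [← mul_assoc, h]
  cases cosetStep s p.1 with
  | inl j => rfl
  | inr t => simp only [mul_assoc, simple_mul_dihedralWord cs h12]

theorem wordProd_word_run
    (h12 : Mat.M 0 1 = 5) (h23 : Mat.M 1 2 = 3) (h13 : Mat.M 0 2 = 2) (ω : List (Fin 3)) :
    cs.wordProd (word (run ω)) = cs.wordProd ω := by
  induction ω with
  | nil => rfl
  | cons s ω ih =>
    rw [wordProd_cons, ← ih, simple_mul_word cs h12 h23 h13]
    rfl

theorem run_eq_of_wordProd_eq
    (h12 : Mat.M 0 1 = 5) (h23 : Mat.M 1 2 = 3) (h13 : Mat.M 0 2 = 2) {ω ω' : List (Fin 3)}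
    (h : cs.wordProd ω = cs.wordProd ω') : run ω = run ω' := by
  have key (ω : List (Fin 3)) :
      cs.lift ⟨_, isLiftable_act h12 h23 h13⟩ (cs.wordProd ω) (0, 0) = run ω := by
    induction ω with
    | nil => rw [wordProd_nil, map_one]; rfl
    | cons s ω ih =>
      rw [wordProd_cons, map_mul, lift_apply_simple, run, List.foldr_cons, ← run, ← ih]
      rfl
  rw [← key, ← key, h]

theorem length_wordProd_word
    (h12 : Mat.M 0 1 = 5) (h23 : Mat.M 1 2 = 3) (h13 : Mat.M 0 2 = 2) (p : State) :
    cs.length (cs.wordProd (word p)) = (word p).length := by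
  refine le_antisymm (cs.length_wordProd_le _) ?_
  obtain ⟨ω, hω, h⟩ := cs.exists_isReduced (cs.wordProd (word p))
  rw [h, hω.eq, ← run_word p, run_eq_of_wordProd_eq cs h12 h23 h13 h]
  exact length_run_le ω

theorem wordProd_word_injective
    (h12 : Mat.M 0 1 = 5) (h23 : Mat.M 1 2 = 3) (h13 : Mat.M 0 2 = 2) :
    Function.Injective fun p => cs.wordProd (word p) := fun p p' h => by
  rw [← run_word p, ← run_word p', run_eq_of_wordProd_eq cs h12 h23 h13 h]

/-- The states of the elements of the standard parabolic subgroup generated by `σ`. -/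
def states (σ : Finset (Fin 3)) : Finset State := {p | ∀ a ∈ word p, a ∈ σ}

theorem coe_parabolic
    (h12 : Mat.M 0 1 = 5) (h23 : Mat.M 1 2 = 3) (h13 : Mat.M 0 2 = 2) (σ : Finset (Fin 3)) :
    (parabolic cs σ : Set W) = (fun p => cs.wordProd (word p)) '' states σ := by
  ext w
  constructor
  · intro hw
    have : ∃ ω : List (Fin 3), (∀ a ∈ ω, a ∈ σ) ∧ cs.wordProd ω = w := by
      induction hw using Subgroup.closure_induction_left with
      | one => exact ⟨[], by simp, by simp⟩
      | mul_left x hx y _ ih =>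
        obtain ⟨s, hs, rfl⟩ := hx
        obtain ⟨ω, hω, rfl⟩ := ih
        exact ⟨s :: ω, by simpa using ⟨hs, hω⟩, cs.wordProd_cons s ω⟩
      | inv_mul_cancel x hx y _ ih =>
        obtain ⟨s, hs, rfl⟩ := hx
        obtain ⟨ω, hω, rfl⟩ := ih
        exact ⟨s :: ω, by simpa using ⟨hs, hω⟩, by rw [cs.wordProd_cons, inv_simple]⟩
    obtain ⟨ω, hω, rfl⟩ := this
    exact ⟨run ω, by simpa [states] using fun a ha => hω a (mem_word_run ω a ha),
      wordProd_word_run cs h12 h23 h13 ω⟩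
  · rintro ⟨p, hp, rfl⟩
    refine Subgroup.list_prod_mem _ fun x hx => ?_
    obtain ⟨a, ha, rfl⟩ := List.mem_map.1 hx
    exact Subgroup.subset_closure ⟨a, (Finset.mem_filter.1 hp).2 a ha, rfl⟩

theorem finite_parabolic
    (h12 : Mat.M 0 1 = 5) (h23 : Mat.M 1 2 = 3) (h13 : Mat.M 0 2 = 2) (σ : Finset (Fin 3)) :
    (parabolic cs σ : Set W).Finite := by
  rw [coe_parabolic cs h12 h23 h13]
  exact (states σ).finite_toSet.image _

theorem poin_eq_sum
    (h12 : Mat.M 0 1 = 5) (h23 : Mat.M 1 2 = 3) (h13 : Mat.M 0 2 = 2) (σ : Finset (Fin 3)) :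
    poin cs σ = ∑ p ∈ states σ, X ^ (word p).length := by
  classical
  have h : (finite_parabolic cs h12 h23 h13 σ).toFinset =
      (states σ).image fun p => cs.wordProd (word p) := by
    ext w
    simp only [Set.Finite.mem_toFinset, coe_parabolic cs h12 h23 h13]
    simp
  rw [poin, dif_pos (finite_parabolic cs h12 h23 h13 σ), h,
    Finset.sum_image (wordProd_word_injective cs h12 h23 h13).injOn]
  simp only [length_wordProd_word cs h12 h23 h13]

/-- The number of elements of length `n` in the standard parabolic subgroup generated by `σ`. -/
def lengthCount (σ : Finset (Fin 3)) (n : ℕ) : ℕ := {p ∈ states σ | (word p).length = n}.card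

theorem poin_eq_sum_lengthCount
    (h12 : Mat.M 0 1 = 5) (h23 : Mat.M 1 2 = 3) (h13 : Mat.M 0 2 = 2) (σ : Finset (Fin 3))
    {l : List ℕ} (hl : (List.range 16).map (lengthCount σ) = l) :
    poin cs σ = ∑ n ∈ Finset.range 16, (l.getD n 0 : ℚ[X]) * X ^ n := by
  rw [poin_eq_sum cs h12 h23 h13, ← Finset.sum_fiberwise_of_maps_to
    (g := fun p => (word p).length) (t := Finset.range 16)
    fun p _ => Finset.mem_range.2 (length_word_lt p)]
  refine Finset.sum_congr rfl fun n hn => ?_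
  rw [Finset.sum_congr rfl fun p hp => by rw [(Finset.mem_filter.1 hp).2], Finset.sum_const,
    nsmul_eq_mul, ← hl]
  simp [Finset.mem_range.1 hn, lengthCount]

theorem poin_empty (h12 : Mat.M 0 1 = 5) (h23 : Mat.M 1 2 = 3) (h13 : Mat.M 0 2 = 2) :
    poin cs ∅ = 1 := by
  rw [poin_eq_sum_lengthCount cs h12 h23 h13 ∅ (l := [1,0,0,0,0,0,0,0,0,0,0,0,0,0,0,0])
    (by decide +kernel)]
  simp [Finset.sum_range_succ]

theorem poin_singleton (h12 : Mat.M 0 1 = 5) (h23 : Mat.M 1 2 = 3) (h13 : Mat.M 0 2 = 2)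
    (s : Fin 3) : poin cs {s} = cyclotomic 2 ℚ := by
  rw [poin_eq_sum_lengthCount cs h12 h23 h13 {s} (l := [1,1,0,0,0,0,0,0,0,0,0,0,0,0,0,0])
    (by revert s; decide +kernel)]
  simp [Finset.sum_range_succ, cyclotomic_two, add_comm]

theorem poin_zero_one (h12 : Mat.M 0 1 = 5) (h23 : Mat.M 1 2 = 3) (h13 : Mat.M 0 2 = 2) :
    poin cs {0, 1} = cyclotomic 2 ℚ * cyclotomic 5 ℚ := by
  rw [poin_eq_sum_lengthCount cs h12 h23 h13 {0, 1} (l := [1,2,2,2,2,1,0,0,0,0,0,0,0,0,0,0])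
    (by decide +kernel)]
  have : Fact (Nat.Prime 5) := ⟨by norm_num⟩
  simp [Finset.sum_range_succ, cyclotomic_prime]
  ring

theorem poin_one_two (h12 : Mat.M 0 1 = 5) (h23 : Mat.M 1 2 = 3) (h13 : Mat.M 0 2 = 2) :
    poin cs {1, 2} = cyclotomic 2 ℚ * cyclotomic 3 ℚ := by
  rw [poin_eq_sum_lengthCount cs h12 h23 h13 {1, 2} (l := [1,2,2,1,0,0,0,0,0,0,0,0,0,0,0,0])
    (by decide +kernel)]
  simp [Finset.sum_range_succ, cyclotomic_two, cyclotomic_three]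
  ring

theorem poin_zero_two (h12 : Mat.M 0 1 = 5) (h23 : Mat.M 1 2 = 3) (h13 : Mat.M 0 2 = 2) :
    poin cs {0, 2} = cyclotomic 2 ℚ * cyclotomic 2 ℚ := by
  rw [poin_eq_sum_lengthCount cs h12 h23 h13 {0, 2} (l := [1,2,1,0,0,0,0,0,0,0,0,0,0,0,0,0])
    (by decide +kernel)]
  simp [Finset.sum_range_succ, cyclotomic_two]
  ring

theorem poin_univ (h12 : Mat.M 0 1 = 5) (h23 : Mat.M 1 2 = 3) (h13 : Mat.M 0 2 = 2) :
    poin cs {0, 1, 2} =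
      cyclotomic 2 ℚ * (cyclotomic 2 ℚ * cyclotomic 3 ℚ * cyclotomic 6 ℚ) *
        (cyclotomic 2 ℚ * cyclotomic 5 ℚ * cyclotomic 10 ℚ) := by
  have h6 := prod_cyclotomic_eq_geom_sum (n := 6) (by norm_num) ℚ
  have h10 := prod_cyclotomic_eq_geom_sum (n := 10) (by norm_num) ℚ
  rw [show (Nat.divisors 6).erase 1 = {2, 3, 6} by decide] at h6
  rw [show (Nat.divisors 10).erase 1 = {2, 5, 10} by decide] at h10
  simp only [Finset.prod_insert, Finset.mem_insert, Finset.mem_singleton, Finset.prod_singleton,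
    Nat.reduceEqDiff, or_self, not_false_eq_true, ← mul_assoc] at h6 h10
  rw [h6, h10, poin_eq_sum_lengthCount cs h12 h23 h13 {0, 1, 2}
    (l := [1,3,5,7,9,11,12,12,12,12,11,9,7,5,3,1]) (by decide +kernel)]
  simp [Finset.sum_range_succ, cyclotomic_two]
  ring

end Group
section Complex

variable {B : Type*} [LinearOrder B] {W : Type*} [Group W] {M : CoxeterMatrix B}
  (cs : CoxeterSystem M W)

theorem bcoeff_erase {σ τ : Finset B} {s : B} (hs : s ∈ σ) (hτ : τ = σ.erase s) {c : ℚ[X]}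
    (hc : poin cs σ = c * poin cs τ) (h0 : poin cs τ ≠ 0) :
    bcoeff cs σ τ = (-1) ^ (σ.filter (· < s)).card * toLaurent c := by
  subst hτ
  rw [bcoeff, Finset.sum_eq_single_of_mem s hs, if_pos rfl, hc, mul_div_cancel_right₀ _ h0]
  intro t ht hts
  refine if_neg fun h => hts ?_
  exact ((Finset.erase_inj σ hs).1 h).symm

theorem bcoeff_eq_zero {σ τ : Finset B} (h : ∀ s ∈ σ, τ ≠ σ.erase s) : bcoeff cs σ τ = 0 :=
  Finset.sum_eq_zero fun s hs => if_neg (h s hs)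

theorem bdry_apply [Fintype B] (k : ℕ) (v : KW cs (k + 1) → R) (τ : KW cs k) :
    bdry cs k v τ = ∑ σ, bcoeff cs σ.1 τ.1 * v σ := rfl

end Complex

section Algebra

theorem cyc_ne_zero (d : ℕ) : cyc d ≠ 0 :=
  (map_ne_zero_iff _ toLaurent_injective).2 (cyclotomic_ne_zero d ℚ)

theorem isCoprime_cyc {m n : ℕ} (h : m ≠ n) : IsCoprime (cyc m) (cyc n) :=
  (cyclotomic.isCoprime_rat h).map toLaurent

/-- If `f : M → N` is surjective with kernel `S`, then `M ⧸ S ≃ N`. -/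
theorem nonempty_quotient_equiv {A M N : Type*} [CommRing A] [AddCommGroup M] [Module A M]
    [AddCommGroup N] [Module A N] (S : Submodule A M) (f : M →ₗ[A] N)
    (hf : Function.Surjective f) (hS : ∀ x, f x = 0 ↔ x ∈ S) : Nonempty ((M ⧸ S) ≃ₗ[A] N) :=
  ⟨(Submodule.quotEquivOfEq S (LinearMap.ker f) (by ext x; simp [hS])).trans
    (f.quotKerEquivOfSurjective hf)⟩

/-- The Chinese remainder theorem for three pairwise coprime elements, as a linear equivalence. -/
theorem nonempty_quotient_equiv_prod {A : Type*} [CommRing A] {p q r : A} (hpq : IsCoprime p q)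
    (hpr : IsCoprime p r) (hqr : IsCoprime q r) :
    Nonempty ((A ⧸ Ideal.span {p * q * r}) ≃ₗ[A]
      ((A ⧸ Ideal.span {p}) × (A ⧸ Ideal.span {q}) × (A ⧸ Ideal.span {r}))) := by
  refine nonempty_quotient_equiv _
    ((Ideal.span {p}).mkQ.prod ((Ideal.span {q}).mkQ.prod (Ideal.span {r}).mkQ)) ?_ ?_
  · rintro ⟨x, y, z⟩
    obtain ⟨x, rfl⟩ := Submodule.mkQ_surjective _ x
    obtain ⟨y, rfl⟩ := Submodule.mkQ_surjective _ y
    obtain ⟨z, rfl⟩ := Submodule.mkQ_surjective _ z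
    obtain ⟨a, b, h⟩ := hpq.mul_right hpr
    obtain ⟨a', b', h'⟩ := hpq.symm.mul_right hqr
    obtain ⟨a'', b'', h''⟩ := hpr.symm.mul_right hqr.symm
    refine ⟨x * (b * (q * r)) + y * (b' * (p * r)) + z * (b'' * (p * q)), ?_⟩
    simp only [LinearMap.prod_apply, Function.prod, Prod.mk.injEq, Submodule.mkQ_apply,
      Submodule.Quotient.eq, Ideal.mem_span_singleton]
    refine ⟨⟨-x * a + y * b' * r + z * b'' * q, ?_⟩, ⟨-y * a' + x * b * r + z * b'' * p, ?_⟩,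
      ⟨-z * a'' + x * b * q + y * b' * p, ?_⟩⟩
    · linear_combination x * h
    · linear_combination y * h'
    · linear_combination z * h''
  · intro x
    simp only [LinearMap.prod_apply, Function.prod, Prod.mk_eq_zero, Submodule.mkQ_apply,
      Submodule.Quotient.mk_eq_zero, Ideal.mem_span_singleton]
    exact ⟨fun ⟨h, h', h''⟩ => (hpr.mul_left hqr).mul_dvd (hpq.mul_dvd h h') h'', fun h =>
      ⟨(dvd_mul_of_dvd_left (dvd_mul_right p q) r).trans h,
        (dvd_mul_of_dvd_left (dvd_mul_left q p) r).trans h, (dvd_mul_left r _).trans h⟩⟩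

/-- The Koszul-type relation between three pairwise coprime elements: surjectivity. -/
theorem exists_solution {A : Type*} [CommRing A] {p q r : A} (hpq : IsCoprime p q)
    (hpr : IsCoprime p r) (hqr : IsCoprime q r) (x y : A) :
    ∃ a b c : A, -(r * a) - p * b = x ∧ r * a - q * c = y := by
  obtain ⟨a, b, h⟩ := hpr
  obtain ⟨c, d, h'⟩ := hqr
  obtain ⟨e, f, h''⟩ := hpq
  have h₁ : b * r * (f * q) = (1 - a * p) * (1 - e * p) := by
    linear_combination (f * q) * h + (1 - a * p) * h''
  have h₂ : d * r * (e * p) = (1 - c * q) * (1 - f * q) := by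
    linear_combination (e * p) * h' + (1 - c * q) * h''
  refine ⟨-(b * x * f * q) + d * y * e * p, -(x * (a + e - a * e * p) + r * d * e * y),
    -(b * r * f * x) - y * (c + f - c * f * q), ?_, ?_⟩
  · linear_combination x * h₁
  · linear_combination y * h₂

/-- The Koszul-type relation between three pairwise coprime elements: the kernel. -/
theorem exists_eq_mul {A : Type*} [CommRing A] [IsDomain A] {p q r : A} (hp : p ≠ 0) (hq : q ≠ 0)
    (hpq : IsCoprime p q) (hpr : IsCoprime p r) (hqr : IsCoprime q r) {a b c : A}
    (h : -(r * a) - p * b = 0) (h' : r * a - q * c = 0) :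
    ∃ t, a = t * (p * q) ∧ b = t * -(q * r) ∧ c = t * (p * r) := by
  have hpa : p ∣ a := hpr.dvd_of_dvd_mul_left ⟨-b, by linear_combination -h⟩
  have hqa : q ∣ a := hqr.dvd_of_dvd_mul_left ⟨c, by linear_combination h'⟩
  obtain ⟨t, rfl⟩ := hpq.mul_dvd hpa hqa
  refine ⟨t, mul_comm _ _, mul_left_cancel₀ hp ?_, mul_left_cancel₀ hq ?_⟩
  · linear_combination -h
  · linear_combination -h'

end Algebra
section Simplices

variable {W : Type*} [Group W] {Mat : CoxeterMatrix (Fin 3)} (cs : CoxeterSystem Mat W)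
  (hfin : ∀ σ : Finset (Fin 3), (parabolic cs σ : Set W).Finite)

/-- The simplex of `K_W` with vertex set `σ`. -/
def simplex (k : ℕ) (σ : Finset (Fin 3)) (hσ : σ.card = k) : KW cs k := ⟨σ, hσ, hfin σ⟩

theorem sum_KW_one (f : KW cs 1 → R) :
    ∑ σ, f σ = f (simplex cs hfin 1 {0} rfl) + f (simplex cs hfin 1 {1} rfl) +
      f (simplex cs hfin 1 {2} rfl) := by
  classical
  have h : (Finset.univ : Finset (KW cs 1)) = {simplex cs hfin 1 {0} rfl,
      simplex cs hfin 1 {1} rfl, simplex cs hfin 1 {2} rfl} := by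
    ext ⟨σ, hσ, hσ'⟩
    have key : ∀ σ : Finset (Fin 3), σ.card = 1 → σ = {0} ∨ σ = {1} ∨ σ = {2} := by decide
    simpa [simplex] using key σ hσ
  rw [h, Finset.sum_insert (by simp [simplex]), Finset.sum_insert (by simp [simplex]),
    Finset.sum_singleton, add_assoc]

theorem sum_KW_two (f : KW cs 2 → R) :
    ∑ σ, f σ = f (simplex cs hfin 2 {0, 1} rfl) + f (simplex cs hfin 2 {0, 2} rfl) +
      f (simplex cs hfin 2 {1, 2} rfl) := by
  classical
  have h : (Finset.univ : Finset (KW cs 2)) = {simplex cs hfin 2 {0, 1} rfl,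
      simplex cs hfin 2 {0, 2} rfl, simplex cs hfin 2 {1, 2} rfl} := by
    ext ⟨σ, hσ, hσ'⟩
    have key : ∀ σ : Finset (Fin 3), σ.card = 2 → σ = {0, 1} ∨ σ = {0, 2} ∨ σ = {1, 2} := by
      decide
    simpa [simplex] using key σ hσ
  have h₁ : ({0, 1} : Finset (Fin 3)) ≠ {0, 2} := by decide
  have h₂ : ({0, 1} : Finset (Fin 3)) ≠ {1, 2} := by decide
  have h₃ : ({0, 2} : Finset (Fin 3)) ≠ {1, 2} := by decide
  rw [h, Finset.sum_insert (by simp [simplex, h₁, h₂]), Finset.sum_insert (by simp [simplex, h₃]),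
    Finset.sum_singleton, add_assoc]

theorem sum_KW_three (f : KW cs 3 → R) :
    ∑ σ, f σ = f (simplex cs hfin 3 {0, 1, 2} rfl) := by
  refine Fintype.sum_eq_single _ fun ⟨σ, hσ, hσ'⟩ h => (h ?_).elim
  have key : ∀ σ : Finset (Fin 3), σ.card = 3 → σ = {0, 1, 2} := by decide
  exact Subtype.ext (key σ hσ)

theorem forall_KW_zero {p : KW cs 0 → Prop} : (∀ σ, p σ) ↔ p (simplex cs hfin 0 ∅ rfl) := by
  refine ⟨fun h => h _, fun h => ?_⟩
  rintro ⟨σ, hσ, hσ'⟩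
  obtain rfl := Finset.card_eq_zero.1 hσ
  exact h

theorem forall_KW_one {p : KW cs 1 → Prop} :
    (∀ σ, p σ) ↔ p (simplex cs hfin 1 {0} rfl) ∧ p (simplex cs hfin 1 {1} rfl) ∧
      p (simplex cs hfin 1 {2} rfl) := by
  refine ⟨fun h => ⟨h _, h _, h _⟩, ?_⟩
  rintro ⟨h₀, h₁, h₂⟩ ⟨σ, hσ, hσ'⟩
  have key : ∀ σ : Finset (Fin 3), σ.card = 1 → σ = {0} ∨ σ = {1} ∨ σ = {2} := by decide
  rcases key σ hσ with rfl | rfl | rfl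
  exacts [h₀, h₁, h₂]

theorem forall_KW_two {p : KW cs 2 → Prop} :
    (∀ σ, p σ) ↔ p (simplex cs hfin 2 {0, 1} rfl) ∧ p (simplex cs hfin 2 {0, 2} rfl) ∧
      p (simplex cs hfin 2 {1, 2} rfl) := by
  refine ⟨fun h => ⟨h _, h _, h _⟩, ?_⟩
  rintro ⟨h₀, h₁, h₂⟩ ⟨σ, hσ, hσ'⟩
  have key : ∀ σ : Finset (Fin 3), σ.card = 2 → σ = {0, 1} ∨ σ = {0, 2} ∨ σ = {1, 2} := by decide
  rcases key σ hσ with rfl | rfl | rfl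
  exacts [h₀, h₁, h₂]

theorem forall_KW_three {p : KW cs 3 → Prop} :
    (∀ σ, p σ) ↔ p (simplex cs hfin 3 {0, 1, 2} rfl) := by
  refine ⟨fun h => h _, ?_⟩
  rintro h ⟨σ, hσ, hσ'⟩
  have key : ∀ σ : Finset (Fin 3), σ.card = 3 → σ = {0, 1, 2} := by decide
  obtain rfl := key σ hσ
  exact h

theorem isEmpty_KW {k : ℕ} (hk : 4 ≤ k) : IsEmpty (KW cs k) :=
  ⟨fun σ => by
    have h := Finset.card_le_univ σ.1
    rw [σ.2.1, Fintype.card_fin] at h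
    omega⟩

/-- The 2-chain with prescribed coefficients. -/
def chainTwo (a b c : R) : KW cs 2 → R := fun σ =>
  if σ.1 = {0, 1} then a else if σ.1 = {0, 2} then b else c

theorem chainTwo_zero_one (a b c : R) :
    chainTwo cs a b c (simplex cs hfin 2 {0, 1} rfl) = a := if_pos rfl

theorem chainTwo_zero_two (a b c : R) :
    chainTwo cs a b c (simplex cs hfin 2 {0, 2} rfl) = b :=
  (if_neg (show ({0, 2} : Finset (Fin 3)) ≠ {0, 1} by decide)).trans (if_pos rfl)

theorem chainTwo_one_two (a b c : R) :
    chainTwo cs a b c (simplex cs hfin 2 {1, 2} rfl) = c :=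
  (if_neg (show ({1, 2} : Finset (Fin 3)) ≠ {0, 1} by decide)).trans
    (if_neg (show ({1, 2} : Finset (Fin 3)) ≠ {0, 2} by decide))

end Simplices

section Homology

variable {W : Type*} [Group W] {Mat : CoxeterMatrix (Fin 3)} (cs : CoxeterSystem Mat W)
  (hfin : ∀ σ : Finset (Fin 3), (parabolic cs σ : Set W).Finite)

theorem bdry_zero (h12 : Mat.M 0 1 = 5) (h23 : Mat.M 1 2 = 3) (h13 : Mat.M 0 2 = 2)
    (v : KW cs 1 → R) :
    bdry cs 0 v (simplex cs hfin 0 ∅ rfl) =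
      cyc 2 * (v (simplex cs hfin 1 {0} rfl) + v (simplex cs hfin 1 {1} rfl) +
        v (simplex cs hfin 1 {2} rfl)) := by
  have h (s : Fin 3) : bcoeff cs {s} ∅ = cyc 2 := by
    rw [bcoeff_erase cs (s := s) (c := cyclotomic 2 ℚ) (by simp) (by simp)
      (by rw [poin_empty cs h12 h23 h13, poin_singleton cs h12 h23 h13, mul_one])
      (by rw [poin_empty cs h12 h23 h13]; exact one_ne_zero),
      Finset.filter_singleton, if_neg (lt_irrefl s), Finset.card_empty, pow_zero, one_mul, cyc]
  rw [bdry_apply, sum_KW_one cs hfin]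
  simp only [simplex, h]
  ring

theorem bdry_one (h12 : Mat.M 0 1 = 5) (h23 : Mat.M 1 2 = 3) (h13 : Mat.M 0 2 = 2)
    (v : KW cs 2 → R) :
    bdry cs 1 v (simplex cs hfin 1 {0} rfl) =
        -(cyc 5 * v (simplex cs hfin 2 {0, 1} rfl)) - cyc 2 * v (simplex cs hfin 2 {0, 2} rfl) ∧
      bdry cs 1 v (simplex cs hfin 1 {1} rfl) =
        cyc 5 * v (simplex cs hfin 2 {0, 1} rfl) - cyc 3 * v (simplex cs hfin 2 {1, 2} rfl) ∧
      bdry cs 1 v (simplex cs hfin 1 {2} rfl) =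
        cyc 2 * v (simplex cs hfin 2 {0, 2} rfl) + cyc 3 * v (simplex cs hfin 2 {1, 2} rfl) := by
  have h0 (s : Fin 3) : poin cs {s} ≠ 0 := by
    rw [poin_singleton cs h12 h23 h13]; exact cyclotomic_ne_zero 2 ℚ
  have key {σ : Finset (Fin 3)} {d : ℕ} (hσ : poin cs σ = cyclotomic 2 ℚ * cyclotomic d ℚ)
      {s t : Fin 3} (hs : s ∈ σ) (ht : {t} = σ.erase s) :
      bcoeff cs σ {t} = (-1) ^ (σ.filter (· < s)).card * cyc d :=
    bcoeff_erase cs hs ht (by rw [hσ, poin_singleton cs h12 h23 h13, mul_comm]) (h0 t)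
  have h01 := poin_zero_one cs h12 h23 h13
  have h02 := poin_zero_two cs h12 h23 h13
  have h12' := poin_one_two cs h12 h23 h13
  have e01_1 : bcoeff cs {0, 1} {1} = cyc 5 := by
    rw [key h01 (s := 0) (by decide) (by decide)]; exact one_mul _
  have e01_0 : bcoeff cs {0, 1} {0} = -cyc 5 := by
    rw [key h01 (s := 1) (by decide) (by decide)]
    exact (congrArg (· * _) (pow_one _)).trans (neg_one_mul _)
  have e02_2 : bcoeff cs {0, 2} {2} = cyc 2 := by
    rw [key h02 (s := 0) (by decide) (by decide)]; exact one_mul _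
  have e02_0 : bcoeff cs {0, 2} {0} = -cyc 2 := by
    rw [key h02 (s := 2) (by decide) (by decide)]
    exact (congrArg (· * _) (pow_one _)).trans (neg_one_mul _)
  have e12_2 : bcoeff cs {1, 2} {2} = cyc 3 := by
    rw [key h12' (s := 1) (by decide) (by decide)]; exact one_mul _
  have e12_1 : bcoeff cs {1, 2} {1} = -cyc 3 := by
    rw [key h12' (s := 2) (by decide) (by decide)]
    exact (congrArg (· * _) (pow_one _)).trans (neg_one_mul _)
  have e01_2 : bcoeff cs {0, 1} {2} = 0 := bcoeff_eq_zero cs (by decide)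
  have e02_1 : bcoeff cs {0, 2} {1} = 0 := bcoeff_eq_zero cs (by decide)
  have e12_0 : bcoeff cs {1, 2} {0} = 0 := bcoeff_eq_zero cs (by decide)
  simp only [bdry_apply, sum_KW_two cs hfin]
  simp only [simplex, e01_0, e01_1, e01_2, e02_0, e02_1, e02_2, e12_0, e12_1, e12_2]
  refine ⟨?_, ?_, ?_⟩ <;> ring

theorem bdry_two (h12 : Mat.M 0 1 = 5) (h23 : Mat.M 1 2 = 3) (h13 : Mat.M 0 2 = 2)
    (v : KW cs 3 → R) :
    bdry cs 2 v = (cyc 2 * cyc 6 * cyc 10 * v (simplex cs hfin 3 {0, 1, 2} rfl)) •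
      chainTwo cs (cyc 2 * cyc 3) (-(cyc 3 * cyc 5)) (cyc 2 * cyc 5) := by
  have h := poin_univ cs h12 h23 h13
  have n2 := cyclotomic_ne_zero 2 ℚ
  have n3 := cyclotomic_ne_zero 3 ℚ
  have n5 := cyclotomic_ne_zero 5 ℚ
  have e01 : bcoeff cs {0, 1, 2} {0, 1} = cyc 2 * cyc 6 * cyc 10 * (cyc 2 * cyc 3) := by
    rw [bcoeff_erase cs (s := 2) (c := cyclotomic 2 ℚ * cyclotomic 6 ℚ * cyclotomic 10 ℚ *
      (cyclotomic 2 ℚ * cyclotomic 3 ℚ)) (by decide) (by decide)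
      (by rw [h, poin_zero_one cs h12 h23 h13]; ring)
      (by rw [poin_zero_one cs h12 h23 h13]; exact mul_ne_zero n2 n5),
      show (Finset.filter (· < 2) ({0, 1, 2} : Finset (Fin 3))).card = 2 by decide]
    simp [cyc]
  have e02 : bcoeff cs {0, 1, 2} {0, 2} = cyc 2 * cyc 6 * cyc 10 * -(cyc 3 * cyc 5) := by
    rw [bcoeff_erase cs (s := 1) (c := cyclotomic 2 ℚ * cyclotomic 6 ℚ * cyclotomic 10 ℚ *
      (cyclotomic 3 ℚ * cyclotomic 5 ℚ)) (by decide) (by decide)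
      (by rw [h, poin_zero_two cs h12 h23 h13]; ring)
      (by rw [poin_zero_two cs h12 h23 h13]; exact mul_ne_zero n2 n2),
      show (Finset.filter (· < 1) ({0, 1, 2} : Finset (Fin 3))).card = 1 by decide]
    simp [cyc]
  have e12 : bcoeff cs {0, 1, 2} {1, 2} = cyc 2 * cyc 6 * cyc 10 * (cyc 2 * cyc 5) := by
    rw [bcoeff_erase cs (s := 0) (c := cyclotomic 2 ℚ * cyclotomic 6 ℚ * cyclotomic 10 ℚ *
      (cyclotomic 2 ℚ * cyclotomic 5 ℚ)) (by decide) (by decide)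
      (by rw [h, poin_one_two cs h12 h23 h13]; ring)
      (by rw [poin_one_two cs h12 h23 h13]; exact mul_ne_zero n2 n3),
      show (Finset.filter (· < 0) ({0, 1, 2} : Finset (Fin 3))).card = 0 by decide]
    simp [cyc]
  refine funext ((forall_KW_two cs hfin).2 ⟨?_, ?_, ?_⟩)
  · rw [Pi.smul_apply, chainTwo_zero_one, smul_eq_mul, bdry_apply, sum_KW_three cs hfin]
    simp only [simplex, e01]
    ring
  · rw [Pi.smul_apply, chainTwo_zero_two, smul_eq_mul, bdry_apply, sum_KW_three cs hfin]
    simp only [simplex, e02]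
    ring
  · rw [Pi.smul_apply, chainTwo_one_two, smul_eq_mul, bdry_apply, sum_KW_three cs hfin]
    simp only [simplex, e12]
    ring

theorem homology_zero (h12 : Mat.M 0 1 = 5) (h23 : Mat.M 1 2 = 3) (h13 : Mat.M 0 2 = 2) :
    Nonempty (Hgy cs 0 ≃ₗ[R] CycQuot 2) := by
  have hfin := finite_parabolic cs h12 h23 h13
  refine nonempty_quotient_equiv _ ((Ideal.span {cyc 2}).mkQ ∘ₗ
    LinearMap.proj (simplex cs hfin 0 ∅ rfl) ∘ₗ (cycles cs 0).subtype) ?_ ?_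
  · intro x
    obtain ⟨x, rfl⟩ := Submodule.mkQ_surjective _ x
    exact ⟨⟨fun _ => x, Submodule.mem_top⟩, rfl⟩
  · rintro ⟨v, hv⟩
    simp only [LinearMap.comp_apply, Submodule.subtype_apply, LinearMap.proj_apply,
      Submodule.mkQ_apply, Submodule.Quotient.mk_eq_zero, Ideal.mem_span_singleton,
      Submodule.mem_comap, LinearMap.mem_range]
    constructor
    · rintro ⟨x, hx⟩
      refine ⟨fun σ => if σ.1 = {0} then x else 0, funext ((forall_KW_zero cs hfin).2 ?_)⟩
      rw [bdry_zero cs hfin h12 h23 h13, hx]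
      simp [simplex]
    · rintro ⟨u, rfl⟩
      exact ⟨_, bdry_zero cs hfin h12 h23 h13 u⟩

theorem homology_one (h12 : Mat.M 0 1 = 5) (h23 : Mat.M 1 2 = 3) (h13 : Mat.M 0 2 = 2) :
    Subsingleton (Hgy cs 1) := by
  have hfin := finite_parabolic cs h12 h23 h13
  rw [Submodule.Quotient.subsingleton_iff, eq_top_iff]
  rintro ⟨v, hv⟩ -
  have h : cyc 2 * _ = 0 := (bdry_zero cs hfin h12 h23 h13 v).symm.trans (congrFun hv _)
  have hsum := (mul_eq_zero.1 h).resolve_left (cyc_ne_zero 2)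
  obtain ⟨a, b, c, h₀, h₁⟩ := exists_solution (isCoprime_cyc (m := 2) (n := 3) (by norm_num))
    (isCoprime_cyc (m := 2) (n := 5) (by norm_num)) (isCoprime_cyc (m := 3) (n := 5) (by norm_num))
    (v (simplex cs hfin 1 {0} rfl)) (v (simplex cs hfin 1 {1} rfl))
  obtain ⟨b₀, b₁, b₂⟩ := bdry_one cs hfin h12 h23 h13 (chainTwo cs a b c)
  rw [chainTwo_zero_one, chainTwo_zero_two] at b₀
  rw [chainTwo_zero_one, chainTwo_one_two] at b₁
  rw [chainTwo_zero_two, chainTwo_one_two] at b₂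
  refine ⟨chainTwo cs a b c, funext ((forall_KW_one cs hfin).2
    ⟨b₀.trans h₀, b₁.trans h₁, b₂.trans ?_⟩)⟩
  change _ = v _
  linear_combination -h₀ - h₁ - hsum

theorem homology_two (h12 : Mat.M 0 1 = 5) (h23 : Mat.M 1 2 = 3) (h13 : Mat.M 0 2 = 2) :
    Nonempty (Hgy cs 2 ≃ₗ[R] (CycQuot 2 × CycQuot 6 × CycQuot 10)) := by
  have hfin := finite_parabolic cs h12 h23 h13
  have n2 := cyc_ne_zero 2
  have n3 := cyc_ne_zero 3
  set z := chainTwo cs (cyc 2 * cyc 3) (-(cyc 3 * cyc 5)) (cyc 2 * cyc 5) with hz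
  have z₀ : z (simplex cs hfin 2 {0, 1} rfl) = _ := chainTwo_zero_one cs hfin _ _ _
  have z₁ : z (simplex cs hfin 2 {0, 2} rfl) = _ := chainTwo_zero_two cs hfin _ _ _
  have z₂ : z (simplex cs hfin 2 {1, 2} rfl) = _ := chainTwo_one_two cs hfin _ _ _
  have hz0 : z (simplex cs hfin 2 {0, 1} rfl) ≠ 0 := by
    rw [z₀]
    exact mul_ne_zero n2 n3
  have hzc : z ∈ cycles cs 2 := by
    obtain ⟨b₀, b₁, b₂⟩ := bdry_one cs hfin h12 h23 h13 z
    rw [z₀, z₁] at b₀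
    rw [z₀, z₂] at b₁
    rw [z₁, z₂] at b₂
    refine funext ((forall_KW_one cs hfin).2 ⟨b₀.trans ?_, b₁.trans ?_, b₂.trans ?_⟩) <;>
      simp only [Pi.zero_apply] <;> ring
  obtain ⟨e⟩ := nonempty_quotient_equiv (Ideal.span {cyc 2 * cyc 6 * cyc 10})
    ((Submodule.comap (cycles cs 2).subtype (LinearMap.range (bdry cs 2))).mkQ ∘ₗ
      LinearMap.toSpanSingleton R (cycles cs 2) ⟨z, hzc⟩) (by
    intro x
    obtain ⟨⟨v, hv⟩, rfl⟩ := Submodule.mkQ_surjective _ x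
    obtain ⟨b₀, b₁, -⟩ := bdry_one cs hfin h12 h23 h13 v
    obtain ⟨t, ha, hb, hc⟩ := exists_eq_mul n2 n3
      (isCoprime_cyc (m := 2) (n := 3) (by norm_num))
      (isCoprime_cyc (m := 2) (n := 5) (by norm_num))
      (isCoprime_cyc (m := 3) (n := 5) (by norm_num))
      (b₀.symm.trans (congrFun hv _)) (b₁.symm.trans (congrFun hv _))
    refine ⟨t, congrArg (Submodule.mkQ _) (Subtype.ext (funext
      ((forall_KW_two cs hfin).2 ⟨?_, ?_, ?_⟩)))⟩
    · exact (congrArg (t * ·) z₀).trans ha.symm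
    · exact (congrArg (t * ·) z₁).trans hb.symm
    · exact (congrArg (t * ·) z₂).trans hc.symm) (by
    intro t
    simp only [LinearMap.comp_apply, LinearMap.toSpanSingleton_apply, Submodule.mkQ_apply,
      Submodule.Quotient.mk_eq_zero, Ideal.mem_span_singleton, Submodule.mem_comap,
      LinearMap.mem_range, Submodule.subtype_apply, Submodule.coe_smul,
      bdry_two cs hfin h12 h23 h13, ← hz]
    constructor
    · rintro ⟨u, hu⟩
      refine ⟨u (simplex cs hfin 3 {0, 1, 2} rfl), (mul_right_cancel₀ hz0 ?_).symm⟩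
      exact congrFun hu (simplex cs hfin 2 {0, 1} rfl)
    · rintro ⟨u, rfl⟩
      exact ⟨fun _ => u, rfl⟩)
  obtain ⟨e'⟩ := nonempty_quotient_equiv_prod (isCoprime_cyc (m := 2) (n := 6) (by norm_num))
    (isCoprime_cyc (m := 2) (n := 10) (by norm_num))
    (isCoprime_cyc (m := 6) (n := 10) (by norm_num))
  exact ⟨e.symm.trans e'⟩

theorem homology_of_three_le (h12 : Mat.M 0 1 = 5) (h23 : Mat.M 1 2 = 3) (h13 : Mat.M 0 2 = 2)
    {k : ℕ} (hk : 3 ≤ k) : Subsingleton (Hgy cs k) := by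
  have hfin := finite_parabolic cs h12 h23 h13
  have : Subsingleton (cycles cs k) := by
    rcases hk.eq_or_lt with rfl | hk
    · refine (Submodule.subsingleton_iff_eq_bot).2 (eq_bot_iff.2 fun v hv => ?_)
      refine funext ((forall_KW_three cs hfin).2 ?_)
      have h := congrFun ((bdry_two cs hfin h12 h23 h13 v).symm.trans hv)
        (simplex cs hfin 2 {0, 1} rfl)
      rw [Pi.smul_apply, chainTwo_zero_one, smul_eq_mul] at h
      have n := cyc_ne_zero
      exact (mul_eq_zero.1 ((mul_eq_zero.1 h).resolve_right (mul_ne_zero (n 2) (n 3)))).resolve_left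
        (mul_ne_zero (mul_ne_zero (n 2) (n 6)) (n 10))
    · have := isEmpty_KW cs hk
      infer_instance
  exact Function.Surjective.subsingleton (Submodule.mkQ_surjective _)

end Homology

end H3

/-- Homology of the weighted complex for the Coxeter system of type `H₃` (generators indexed by `0,1,2` corresponding to `1,2,3`). -/
theorem homology_H3 {W : Type*} [Group W] {Mat : CoxeterMatrix (Fin 3)}
    (cs : CoxeterSystem Mat W)
    (h12 : Mat.M 0 1 = 5) (h23 : Mat.M 1 2 = 3) (h13 : Mat.M 0 2 = 2) :
    Nonempty (Hgy cs 0 ≃ₗ[R] (CycQuot 2)) ∧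
    Subsingleton (Hgy cs 1) ∧
    Nonempty (Hgy cs 2 ≃ₗ[R] (CycQuot 2 × CycQuot 6 × CycQuot 10)) ∧
    (∀ k, 3 ≤ k → Subsingleton (Hgy cs k)) := by
  exact ⟨H3.homology_zero cs h12 h23 h13, H3.homology_one cs h12 h23 h13,
    H3.homology_two cs h12 h23 h13, fun _ hk => H3.homology_of_three_le cs h12 h23 h13 hk⟩
end

section
/- Let (W,S) be the Coxeter system of type H_4: S = {1,2,3,4} with m(1,2) = 5, m(2,3) = 3, m(3,4) = 3 and all other pairs commuting (m = 2). Then the homology of the weighted complex C_*(W) is: H_0 ≅ R/(Φ_2); H_1 = H_2 = 0; H_3 ≅ R/(Φ_2) ⊕ R/(Φ_3) ⊕ R/(Φ_4) ⊕ R/(Φ_5) ⊕ R/(Φ_6) ⊕ R/(Φ_10) ⊕ R/(Φ_12) ⊕ R/(Φ_15) ⊕ R/(Φ_20) ⊕ R/(Φ_30); and H_k = 0 for all k ≥ 4. -/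
open Polynomial CoxeterSystem

set_option synthInstance.maxHeartbeats 1000000
set_option maxHeartbeats 1000000

namespace H4

/-! ### The geometric representation over `ℤ[φ]` -/

/-- The ring `ℤ[φ]`, where `φ² = φ + 1`. -/
abbrev ZPhi : Type := QuadraticAlgebra ℤ 1 1

/-- The Coxeter matrix entries of type `H₄`. -/
def coxEntry : Fin 4 → Fin 4 → ℕ :=
  ![![1, 5, 2, 2], ![5, 1, 3, 2], ![2, 3, 1, 3], ![2, 2, 3, 1]]

/-- The Cartan matrix of type `H₄`, up to sign: the entry at `(i, j)` is
`2 cos (π / m(i, j))`. -/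
def cartan : Fin 4 → Fin 4 → ZPhi :=
  ![![-2, ⟨0, 1⟩, 0, 0], ![⟨0, 1⟩, -2, 1, 0], ![0, 1, -2, 1], ![0, 0, 1, -2]]

/-- The simple root `α_i`. -/
def root (i : Fin 4) : Fin 4 → ZPhi := Pi.single i 1

/-- The simple coroot, as a linear functional. -/
def coroot (i : Fin 4) : (Fin 4 → ZPhi) →ₗ[ZPhi] ZPhi :=
  -∑ j, cartan i j • LinearMap.proj j

/-- The simple reflection in the geometric representation. -/
def refl (i : Fin 4) : Module.End ZPhi (Fin 4 → ZPhi) :=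
  LinearMap.id - (coroot i).smulRight (root i)

lemma refl_apply (i : Fin 4) (v : Fin 4 → ZPhi) : refl i v = v - coroot i v • root i := by
  simp [refl]

lemma coroot_root (i j : Fin 4) : coroot i (root j) = -cartan i j := by
  simp [coroot, root, Pi.single_apply]

lemma cartan_self (i : Fin 4) : cartan i i = -2 := by
  fin_cases i <;> rfl

lemma cartan_symm (i j : Fin 4) : cartan i j = cartan j i := by
  fin_cases i <;> fin_cases j <;> rfl

lemma coxEntry_symm (i j : Fin 4) : coxEntry i j = coxEntry j i := by
  fin_cases i <;> fin_cases j <;> rfl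

lemma coxEntry_cartan (i j : Fin 4) (h : i ≠ j) :
    (coxEntry i j = 2 ∧ cartan i j = 0) ∨ (coxEntry i j = 3 ∧ cartan i j = 1) ∨
      (coxEntry i j = 5 ∧ cartan i j = ⟨0, 1⟩) := by
  revert h; revert i j; decide

lemma refl_comb_left (i j : Fin 4) (v : Fin 4 → ZPhi) (x y : ZPhi) :
    refl i (v + x • root i + y • root j) =
      v + (cartan i j * y - x - coroot i v) • root i + y • root j := by
  simp only [refl_apply, map_add, map_smul, coroot_root, cartan_self]
  module

lemma refl_comb_right (i j : Fin 4) (v : Fin 4 → ZPhi) (x y : ZPhi) :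
    refl j (v + x • root i + y • root j) =
      v + x • root i + (cartan i j * x - y - coroot j v) • root j := by
  simp only [refl_apply, map_add, map_smul, coroot_root, cartan_self,
    cartan_symm j i]
  module

lemma refl_isLiftable {Mat : CoxeterMatrix (Fin 4)} (hM : ∀ i j, Mat i j = coxEntry i j) :
    Mat.IsLiftable refl := by
  intro i j
  rw [hM]
  by_cases hij : i = j
  · subst hij
    have h1 : coxEntry i i = 1 := by revert i; decide
    rw [h1, pow_one]
    refine LinearMap.ext fun v => ?_
    simp only [Module.End.mul_apply, refl_apply, map_sub, map_smul, coroot_root, cartan_self,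
      Module.End.one_apply]
    module
  · refine LinearMap.ext fun v => ?_
    have hv : v = v + (0 : ZPhi) • root i + (0 : ZPhi) • root j := by simp
    rw [Module.End.one_apply]
    conv_lhs => rw [hv]
    conv_rhs => rw [hv]
    rcases coxEntry_cartan i j hij with ⟨h1, h2⟩ | ⟨h1, h2⟩ | ⟨h1, h2⟩ <;>
    · rw [h1]
      simp only [pow_succ, pow_zero, one_mul, Module.End.mul_apply, refl_comb_left,
        refl_comb_right, h2]
      congr 3 <;> (apply QuadraticAlgebra.ext <;> simp <;> ring)

/-- The cone of vectors with nonnegative coordinates. -/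
def Pos (v : Fin 4 → ZPhi) : Prop := ∀ k, 0 ≤ (v k).re ∧ 0 ≤ (v k).im

instance (v : Fin 4 → ZPhi) : Decidable (Pos v) := by unfold Pos; infer_instance

lemma Pos.add {v w : Fin 4 → ZPhi} (hv : Pos v) (hw : Pos w) : Pos (v + w) := fun k =>
  ⟨add_nonneg (hv k).1 (hw k).1, add_nonneg (hv k).2 (hw k).2⟩

lemma Pos.smul {a : ZPhi} (h1 : 0 ≤ a.re) (h2 : 0 ≤ a.im) {v : Fin 4 → ZPhi} (hv : Pos v) :
    Pos (a • v) := by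
  intro k
  have h3 := mul_nonneg h1 (hv k).1
  have h4 := mul_nonneg h2 (hv k).1
  have h5 := mul_nonneg h1 (hv k).2
  have h6 := mul_nonneg h2 (hv k).2
  constructor <;> simp <;> linarith

lemma pos_zero : Pos 0 := by decide

lemma pos_root (i : Fin 4) : Pos (root i) := by revert i; decide

lemma Pos.eq_zero {v : Fin 4 → ZPhi} (hv : Pos v) (hv' : Pos (-v)) : v = 0 := by
  funext k
  have h1 := hv k
  have h2 := hv' k
  simp at h2
  exact QuadraticAlgebra.ext (le_antisymm h2.1 h1.1) (le_antisymm h2.2 h1.2)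

lemma eq_sum_root (v : Fin 4 → ZPhi) : v = ∑ k, v k • root k := by
  funext j
  simp [root, Finset.sum_apply, Pi.single_apply]

section Group

variable {W : Type*} [Group W] {Mat : CoxeterMatrix (Fin 4)} (cs : CoxeterSystem Mat W)
  (hM : ∀ i j, Mat i j = coxEntry i j)

/-- The geometric representation of a Coxeter group of type `H₄`. -/
noncomputable def rep : W →* Module.End ZPhi (Fin 4 → ZPhi) :=
  cs.lift ⟨refl, refl_isLiftable hM⟩

lemma rep_simple (i : Fin 4) : rep cs hM (cs.simple i) = refl i :=
  cs.lift_apply_simple (refl_isLiftable hM) i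

lemma rep_mul_simple_root (w : W) (i : Fin 4) :
    rep cs hM (w * cs.simple i) (root i) = -rep cs hM w (root i) := by
  rw [map_mul, Module.End.mul_apply, rep_simple, refl_apply, coroot_root, cartan_self, ← map_neg]
  congr 1
  module

lemma rep_root_ne_zero (w : W) (i : Fin 4) : rep cs hM w (root i) ≠ 0 := by
  intro h
  have h1 : rep cs hM w⁻¹ (rep cs hM w (root i)) = root i := by
    rw [← Module.End.mul_apply, ← map_mul]; simp
  rw [h, map_zero] at h1
  have h2 := congrFun h1 i
  simp [root] at h2

/-- The action of an alternating word of length `< m(s, t)` ending in `t` on `α_s`. -/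
lemma rep_alternating (s t : Fin 4) (hst : s ≠ t) (k : ℕ) (hk : k < coxEntry s t) :
    ∃ p q : ZPhi, 0 ≤ p.re ∧ 0 ≤ p.im ∧ 0 ≤ q.re ∧ 0 ≤ q.im ∧
      rep cs hM (cs.wordProd (alternatingWord s t k)) (root s) = p • root s + q • root t := by
  have h0 : root s = 0 + (1 : ZPhi) • root s + (0 : ZPhi) • root t := by simp
  rcases coxEntry_cartan s t hst with ⟨h1, h2⟩ | ⟨h1, h2⟩ | ⟨h1, h2⟩ <;>
  · rw [h1] at hk
    interval_cases k <;>
    · simp only [alternatingWord, List.concat_eq_append, List.nil_append, List.cons_append,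
        wordProd_cons, wordProd_nil, map_mul, map_one, rep_simple,
        Module.End.mul_apply, Module.End.one_apply]
      conv in root s => rw [h0]
      try simp only [refl_comb_left, refl_comb_right, h2, map_zero]
      refine ⟨_, _, ?_, ?_, ?_, ?_, congrArg (· + _) (zero_add _)⟩ <;> decide

lemma exists_alternating_succ_of_le (w : W) (s t : Fin 4) (j k : ℕ) (hjk : j ≤ k)
    (h : ∃ v, w = v * cs.wordProd (alternatingWord s t k) ∧ cs.length v + k = cs.length w) :
    ∃ v, w = v * cs.wordProd (alternatingWord s t j) ∧ cs.length v + j = cs.length w := by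
  induction k with
  | zero => obtain rfl : j = 0 := by omega
            exact h
  | succ k ih =>
    rcases Nat.lt_or_ge k j with hlt | hle
    · obtain rfl : j = k + 1 := by omega
      exact h
    · obtain ⟨v, hv, hl⟩ := h
      rw [alternatingWord_succ', wordProd_cons, ← mul_assoc] at hv
      refine ih hle ⟨_, hv, ?_⟩
      have h1 := cs.length_mul_le (v * cs.simple (if Even k then t else s))
        (cs.wordProd (alternatingWord s t k))
      rw [← hv] at h1
      have h2 := cs.length_wordProd_le (alternatingWord s t k)
      rw [length_alternatingWord] at h2
      have h3 := cs.length_mul_le v (cs.simple (if Even k then t else s))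
      rw [length_simple] at h3
      omega

theorem pos_of_length_lt (n : ℕ) : ∀ w : W, cs.length w = n → ∀ s : Fin 4,
    cs.length w < cs.length (w * cs.simple s) → Pos (rep cs hM w (root s)) := by
  induction n using Nat.strong_induction_on with
  | _ n ih =>
  intro w hn s hs
  by_cases hw : w = 1
  · subst hw
    simpa using pos_root s
  obtain ⟨t, ht⟩ := cs.exists_rightDescent_of_ne_one hw
  rw [isRightDescent_iff] at ht
  have hst : s ≠ t := by rintro rfl; omega
  classical
  let P : ℕ → Prop := fun k =>
    ∃ v, w = v * cs.wordProd (alternatingWord s t k) ∧ cs.length v + k = cs.length w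
  have hP1 : P 1 := ⟨w * cs.simple t, by simp [alternatingWord], ht⟩
  have hbound : ∀ k, P k → k ≤ cs.length w := by
    rintro k ⟨v, -, hv⟩; omega
  set K := Nat.findGreatest P (cs.length w) with hK
  have hK1 : 1 ≤ K := Nat.le_findGreatest (hbound 1 hP1) hP1
  have hPK : P K := Nat.findGreatest_spec (hbound 1 hP1) hP1
  have hmax : ¬ P (K + 1) := fun h => by
    have := Nat.le_findGreatest (hbound _ h) h
    omega
  have hKm : K < coxEntry s t := by
    by_contra hge
    obtain ⟨v, hv, hl⟩ := exists_alternating_succ_of_le cs w s t _ K (not_lt.mp hge) hPK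
    have hb := cs.wordProd_braidWord_eq s t
    rw [braidWord, braidWord, hM, hM, coxEntry_symm t s] at hb
    obtain ⟨m, hm⟩ : ∃ m, coxEntry s t = m + 1 := by
      rcases coxEntry_cartan s t hst with h | h | h <;> exact ⟨_, h.1⟩
    rw [hb, hm, alternatingWord_succ, wordProd_concat] at hv
    have h1 := cs.length_mul_le v (cs.wordProd (alternatingWord s t m))
    have h2 := cs.length_wordProd_le (alternatingWord s t m)
    rw [length_alternatingWord] at h2
    rw [hv, ← mul_assoc, simple_mul_simple_cancel_right] at hs
    rw [← mul_assoc] at hv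
    rw [← hv] at hs
    omega
  obtain ⟨v, hv, hl⟩ := hPK
  obtain ⟨m, hm⟩ : ∃ m, K = m + 1 := ⟨K - 1, by omega⟩
  have hx : cs.length v < cs.length (v * cs.simple (if Even m then t else s)) := by
    by_contra hlt
    have h0 := cs.length_mul_simple_ne v (if Even m then t else s)
    rw [hm, alternatingWord_succ', wordProd_cons, ← mul_assoc] at hv
    have h1 := cs.length_mul_le (v * cs.simple (if Even m then t else s))
      (cs.wordProd (alternatingWord s t m))
    rw [← hv] at h1
    have h2 := cs.length_wordProd_le (alternatingWord s t m)
    rw [length_alternatingWord] at h2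
    omega
  have hy : cs.length v < cs.length (v * cs.simple (if Even K then t else s)) := by
    by_contra hlt
    have h0 := cs.length_mul_simple v (if Even K then t else s)
    apply hmax
    refine ⟨v * cs.simple (if Even K then t else s), ?_, by omega⟩
    rw [alternatingWord_succ', wordProd_cons, ← mul_assoc, simple_mul_simple_cancel_right]
    exact hv
  have hboth : cs.length v < cs.length (v * cs.simple s) ∧
      cs.length v < cs.length (v * cs.simple t) := by
    rw [hm] at hy
    by_cases he : Even m
    · rw [if_pos he] at hx
      rw [if_neg (by simpa [Nat.even_add_one] using he)] at hy
      exact ⟨hy, hx⟩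
    · rw [if_neg he] at hx
      rw [if_pos (by simpa [Nat.even_add_one] using he)] at hy
      exact ⟨hx, hy⟩
  obtain ⟨p, q, hp1, hp2, hq1, hq2, hpq⟩ := rep_alternating cs hM s t hst K hKm
  rw [hv, map_mul, Module.End.mul_apply, hpq, map_add, map_smul, map_smul]
  exact (Pos.smul hp1 hp2 (ih _ (by omega) v rfl s hboth.1)).add
    (Pos.smul hq1 hq2 (ih _ (by omega) v rfl t hboth.2))

theorem length_lt_iff (w : W) (s : Fin 4) :
    cs.length w < cs.length (w * cs.simple s) ↔ Pos (rep cs hM w (root s)) := by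
  refine ⟨pos_of_length_lt cs hM _ w rfl s, fun h => ?_⟩
  by_contra hlt
  have h1 := cs.length_mul_simple w s
  have h2 := pos_of_length_lt cs hM _ (w * cs.simple s) rfl s (by simp; omega)
  rw [rep_mul_simple_root] at h2
  exact rep_root_ne_zero cs hM w s (h.eq_zero h2)

theorem length_gt_iff (w : W) (s : Fin 4) :
    cs.length (w * cs.simple s) < cs.length w ↔ Pos (-rep cs hM w (root s)) := by
  rw [← rep_mul_simple_root, ← length_lt_iff, simple_mul_simple_cancel_right]

end Group

section Group

variable {W : Type*} [Group W] {Mat : CoxeterMatrix (Fin 4)} (cs : CoxeterSystem Mat W)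
  (hM : ∀ i j, Mat i j = coxEntry i j)

/-! ### Parabolic subgroups -/

lemma simple_mem_parabolic {σ : Finset (Fin 4)} {s : Fin 4} (hs : s ∈ σ) :
    cs.simple s ∈ parabolic cs σ :=
  Subgroup.subset_closure ⟨s, hs, rfl⟩

lemma parabolic_mono {σ τ : Finset (Fin 4)} (h : τ ⊆ σ) : parabolic cs τ ≤ parabolic cs σ :=
  Subgroup.closure_mono (Set.image_mono h)

include hM in
lemma rep_parabolic_apply {σ : Finset (Fin 4)} {u : W} (hu : u ∈ parabolic cs σ) :
    ∀ (v : Fin 4 → ZPhi) (k : Fin 4), k ∉ σ → rep cs hM u v k = v k := by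
  induction hu using Subgroup.closure_induction with
  | mem x hx =>
    obtain ⟨s, hs, rfl⟩ := hx
    intro v k hk
    have hne : k ≠ s := by rintro rfl; exact hk hs
    simp [rep_simple, refl_apply, root, hne]
  | one => simp
  | mul x y _ _ hx hy =>
    intro v k hk
    rw [map_mul, Module.End.mul_apply, hx _ k hk, hy _ k hk]
  | inv x _ hx =>
    intro v k hk
    refine (hx _ k hk).symm.trans ?_
    rw [← Module.End.mul_apply, ← map_mul]
    simp

include hM in
/-- Every element of a parabolic subgroup is built up by length-increasing right
multiplications by generators of that subgroup. -/
lemma parabolic_induction {σ : Finset (Fin 4)} {p : W → Prop} (one : p 1)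
    (mul : ∀ u ∈ parabolic cs σ, ∀ s ∈ σ, cs.length u < cs.length (u * cs.simple s) → p u →
      p (u * cs.simple s)) (u : W) (hu : u ∈ parabolic cs σ) : p u := by
  induction h : cs.length u generalizing u with
  | zero => rw [length_eq_zero_iff] at h; exact h ▸ one
  | succ n ih =>
    have hu1 : u ≠ 1 := by rintro rfl; simp at h
    obtain ⟨s, hs⟩ := cs.exists_rightDescent_of_ne_one hu1
    have hsσ : s ∈ σ := by
      by_contra hsσ
      have h1 := (length_gt_iff cs hM u s).1 hs s
      rw [Pi.neg_apply, rep_parabolic_apply cs hM hu _ s hsσ] at h1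
      simp only [root, Pi.single_eq_same] at h1
      revert h1
      decide
    have hs' := cs.isRightDescent_iff.1 hs
    have := mul (u * cs.simple s) (mul_mem hu (simple_mem_parabolic cs hsσ)) s hsσ
      (by rw [simple_mul_simple_cancel_right]; exact hs)
      (ih _ (mul_mem hu (simple_mem_parabolic cs hsσ)) (by omega))
    rwa [simple_mul_simple_cancel_right] at this

lemma pos_sum {σ : Finset (Fin 4)} {f : Fin 4 → Fin 4 → ZPhi} (h : ∀ k ∈ σ, Pos (f k)) :
    Pos (∑ k ∈ σ, f k) := by
  induction σ using Finset.cons_induction with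
  | empty => exact pos_zero
  | cons a s ha ih =>
    rw [Finset.sum_cons]
    exact (h a (by simp)).add (ih fun k hk => h k (by simp [hk]))

include hM in
lemma rep_mul_root_eq_sum {σ : Finset (Fin 4)} (x : W) {u : W} (hu : u ∈ parabolic cs σ)
    {s : Fin 4} (hs : s ∈ σ) :
    rep cs hM (x * u) (root s) =
      ∑ k ∈ σ, (rep cs hM u (root s) k) • rep cs hM x (root k) := by
  rw [map_mul, Module.End.mul_apply]
  conv_lhs => rw [eq_sum_root (rep cs hM u (root s)), map_sum]
  rw [← Finset.sum_subset (Finset.subset_univ σ)]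
  · simp
  · intro k _ hk
    have hne : k ≠ s := by rintro rfl; exact hk hs
    rw [rep_parabolic_apply cs hM hu _ k hk]
    simp [root, hne]

include hM in
lemma length_mul_of_ascents {σ : Finset (Fin 4)} {x : W}
    (hx : ∀ s ∈ σ, cs.length x < cs.length (x * cs.simple s)) (u : W)
    (hu : u ∈ parabolic cs σ) : cs.length (x * u) = cs.length x + cs.length u := by
  refine parabolic_induction cs hM (p := fun u => cs.length (x * u) = cs.length x + cs.length u)
    (by simp) (fun u hu s hs hlt ih => ?_) u hu
  have hpos := (length_lt_iff cs hM u s).1 hlt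
  have h1 : cs.length (x * u) < cs.length (x * u * cs.simple s) := by
    rw [length_lt_iff cs hM, rep_mul_root_eq_sum cs hM x hu hs]
    exact pos_sum fun k hk =>
      Pos.smul (hpos k).1 (hpos k).2 ((length_lt_iff cs hM x k).1 (hx k hk))
  have h2 := cs.length_mul_simple u s
  have h3 := cs.length_mul_simple (x * u) s
  rw [← mul_assoc]
  omega

include hM in
lemma length_mul_of_descents {σ : Finset (Fin 4)} {x : W}
    (hx : ∀ s ∈ σ, cs.length (x * cs.simple s) < cs.length x) (u : W)
    (hu : u ∈ parabolic cs σ) : cs.length (x * u) + cs.length u = cs.length x := by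
  refine parabolic_induction cs hM (p := fun u => cs.length (x * u) + cs.length u = cs.length x)
    (by simp) (fun u hu s hs hlt ih => ?_) u hu
  have hpos := (length_lt_iff cs hM u s).1 hlt
  have h1 : cs.length (x * u * cs.simple s) < cs.length (x * u) := by
    rw [length_gt_iff cs hM, rep_mul_root_eq_sum cs hM x hu hs, ← Finset.sum_neg_distrib]
    refine pos_sum fun k hk => ?_
    rw [← smul_neg]
    exact Pos.smul (hpos k).1 (hpos k).2 ((length_gt_iff cs hM x k).1 (hx k hk))
  have h2 := cs.length_mul_simple u s
  have h3 := cs.length_mul_simple (x * u) s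
  rw [← mul_assoc]
  omega

lemma finite_length_le (n : ℕ) : {w : W | cs.length w ≤ n}.Finite := by
  refine ((List.finite_length_le (Fin 4) n).image cs.wordProd).subset fun w hw => ?_
  obtain ⟨ω, hω, rfl⟩ := cs.exists_isReduced w
  refine ⟨ω, ?_, rfl⟩
  rw [Set.mem_ofPred_eq, hω.eq] at hw
  exact hw

include hM in
lemma parabolic_finite {σ : Finset (Fin 4)} {x : W}
    (hx : ∀ s ∈ σ, cs.length (x * cs.simple s) < cs.length x) :
    (parabolic cs σ : Set W).Finite :=
  (finite_length_le cs (cs.length x)).subset fun u hu => by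
    have := length_mul_of_descents cs hM hx u hu
    simp only [Set.mem_ofPred_eq]
    omega

include hM in
lemma eq_of_descents {σ : Finset (Fin 4)} {x y : W} (hx' : x ∈ parabolic cs σ)
    (hy' : y ∈ parabolic cs σ)
    (hx : ∀ s ∈ σ, cs.length (x * cs.simple s) < cs.length x)
    (hy : ∀ s ∈ σ, cs.length (y * cs.simple s) < cs.length y) : x = y := by
  have h1 := length_mul_of_descents cs hM hx (x⁻¹ * y) (mul_mem (inv_mem hx') hy')
  have h2 := length_mul_of_descents cs hM hy (y⁻¹ * x) (mul_mem (inv_mem hy') hx')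
  rw [mul_inv_cancel_left] at h1 h2
  have h3 : cs.length (x⁻¹ * y) = 0 := by omega
  rw [length_eq_zero_iff] at h3
  exact (inv_mul_eq_one.1 h3)

lemma poin_eq_sum {σ : Finset (Fin 4)} (h : (parabolic cs σ : Set W).Finite) :
    poin cs σ = ∑ w ∈ h.toFinset, X ^ cs.length w := by
  simp [poin, h]

open Classical in
/-- The generating function of the minimal coset representatives of `W_σ / W_J`. -/
noncomputable def cosetPoin {σ : Finset (Fin 4)} (h : (parabolic cs σ : Set W).Finite)
    (J : Finset (Fin 4)) : ℚ[X] :=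
  ∑ w ∈ h.toFinset with ∀ s ∈ J, cs.length w < cs.length (w * cs.simple s), X ^ cs.length w

include hM in
lemma poin_eq_mul_cosetPoin {σ J : Finset (Fin 4)} (h : (parabolic cs σ : Set W).Finite)
    (hJ : J ⊆ σ) : poin cs σ = poin cs J * cosetPoin cs h J := by
  classical
  have hJ' : (parabolic cs J : Set W).Finite := h.subset (parabolic_mono cs hJ)
  rw [poin_eq_sum cs h, poin_eq_sum cs hJ', cosetPoin, mul_comm, Finset.sum_mul_sum,
    ← Finset.sum_product']
  symm
  refine Finset.sum_bij (fun p _ => p.1 * p.2) ?_ ?_ ?_ ?_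
  · rintro ⟨x, u⟩ hp
    simp only [Finset.mem_product, Finset.mem_filter, Set.Finite.mem_toFinset,
      SetLike.mem_coe] at hp ⊢
    exact mul_mem hp.1.1 (parabolic_mono cs hJ hp.2)
  · rintro ⟨x, u⟩ hp ⟨y, v⟩ hq heq
    simp only [Finset.mem_product, Finset.mem_filter, Set.Finite.mem_toFinset,
      SetLike.mem_coe] at hp hq heq
    have e1 : x * (u * v⁻¹) = y := by rw [← mul_assoc, heq, mul_inv_cancel_right]
    have e2 : y * (v * u⁻¹) = x := by rw [← mul_assoc, ← heq, mul_inv_cancel_right]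
    have l1 := length_mul_of_ascents cs hM hp.1.2 _ (mul_mem hp.2 (inv_mem hq.2))
    have l2 := length_mul_of_ascents cs hM hq.1.2 _ (mul_mem hq.2 (inv_mem hp.2))
    rw [e1] at l1
    rw [e2] at l2
    have h3 : cs.length (u * v⁻¹) = 0 := by omega
    rw [length_eq_zero_iff] at h3
    have huv : u = v := mul_inv_eq_one.1 h3
    subst huv
    simpa using heq
  · intro w hw
    simp only [Set.Finite.mem_toFinset, SetLike.mem_coe] at hw
    obtain ⟨u, hu, hmin⟩ := Set.exists_min_image (parabolic cs J : Set W)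
      (fun u => cs.length (w * u)) hJ' ⟨1, one_mem _⟩
    refine ⟨(w * u, u⁻¹), ?_, by simp⟩
    simp only [Finset.mem_product, Finset.mem_filter, Set.Finite.mem_toFinset,
      SetLike.mem_coe]
    refine ⟨⟨mul_mem hw (parabolic_mono cs hJ hu), fun s hs => ?_⟩, inv_mem hu⟩
    have h1 := hmin (u * cs.simple s) (mul_mem hu (simple_mem_parabolic cs hs))
    have h2 := cs.length_mul_simple_ne (w * u) s
    rw [← mul_assoc] at h1
    omega
  · rintro ⟨x, u⟩ hp
    simp only [Finset.mem_product, Finset.mem_filter, Set.Finite.mem_toFinset,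
      SetLike.mem_coe] at hp
    rw [length_mul_of_ascents cs hM hp.1.2 u hp.2, pow_add]

include hM in
lemma sum_cosetPoin {σ : Finset (Fin 4)} (h : (parabolic cs σ : Set W).Finite) {x : W}
    (hx' : x ∈ parabolic cs σ)
    (hx : ∀ s ∈ σ, cs.length (x * cs.simple s) < cs.length x) :
    ∑ J ∈ σ.powerset, (-1) ^ J.card * cosetPoin cs h J = X ^ cs.length x := by
  classical
  simp only [cosetPoin, Finset.sum_filter, Finset.mul_sum]
  rw [Finset.sum_comm]
  have key : ∀ w ∈ h.toFinset, (∑ J ∈ σ.powerset, (-1 : ℚ[X]) ^ J.card *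
      (if ∀ s ∈ J, cs.length w < cs.length (w * cs.simple s) then X ^ cs.length w else 0)) =
      if w = x then X ^ cs.length w else 0 := by
    intro w hw
    simp only [Set.Finite.mem_toFinset, SetLike.mem_coe] at hw
    set A := σ.filter fun s => cs.length w < cs.length (w * cs.simple s) with hA
    have h1 : (∑ J ∈ σ.powerset, (-1 : ℚ[X]) ^ J.card *
        (if ∀ s ∈ J, cs.length w < cs.length (w * cs.simple s) then X ^ cs.length w else 0)) =
        ∑ J ∈ A.powerset, (-1 : ℚ[X]) ^ J.card * X ^ cs.length w := by
      simp only [mul_ite, mul_zero]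
      rw [← Finset.sum_filter]
      refine Finset.sum_congr ?_ fun _ _ => rfl
      ext J
      simp only [Finset.mem_filter, Finset.mem_powerset, hA, Finset.subset_iff]
      exact ⟨fun H s hs => ⟨H.1 hs, H.2 s hs⟩, fun H => ⟨fun s hs => (H hs).1,
        fun s hs => (H hs).2⟩⟩
    have h2 : (∑ J ∈ A.powerset, (-1 : ℚ[X]) ^ J.card) = if A = ∅ then 1 else 0 := by
      have := congrArg (Int.cast : ℤ → ℚ[X]) (Finset.sum_powerset_neg_one_pow_card (x := A))
      push_cast at this
      exact this
    rw [h1, ← Finset.sum_mul, h2, ite_mul, one_mul, zero_mul]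
    refine if_congr ?_ rfl rfl
    rw [hA, Finset.filter_eq_empty_iff]
    constructor
    · intro H
      refine eq_of_descents cs hM hw hx' (fun s hs => ?_) hx
      have h3 := H hs
      have h4 := cs.length_mul_simple_ne w s
      omega
    · rintro rfl s hs
      have := hx s hs
      omega
  rw [Finset.sum_congr rfl key, Finset.sum_ite_eq', if_pos (by simpa using hx')]

end Group

/-! ### Longest elements -/

/-- A vector of `ℤ[φ]⁴`, given by its eight integer coordinates. -/
structure IntVec where
  (a₀ b₀ a₁ b₁ a₂ b₂ a₃ b₃ : ℤ)

/-- The vector with the given integer coordinates. -/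
def IntVec.toVec (v : IntVec) : Fin 4 → ZPhi :=
  ![⟨v.a₀, v.b₀⟩, ⟨v.a₁, v.b₁⟩, ⟨v.a₂, v.b₂⟩, ⟨v.a₃, v.b₃⟩]

/-- The simple root, in integer coordinates. -/
def intRoot : Fin 4 → IntVec :=
  ![⟨1, 0, 0, 0, 0, 0, 0, 0⟩, ⟨0, 0, 1, 0, 0, 0, 0, 0⟩, ⟨0, 0, 0, 0, 1, 0, 0, 0⟩,
    ⟨0, 0, 0, 0, 0, 0, 1, 0⟩]

/-- The simple reflection, in integer coordinates. -/
def intRefl (v : IntVec) (i : Fin 4) : IntVec :=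
  match v, i with
  | ⟨a₀, b₀, a₁, b₁, a₂, b₂, a₃, b₃⟩, 0 => ⟨b₁ - a₀, a₁ + b₁ - b₀, a₁, b₁, a₂, b₂, a₃, b₃⟩
  | ⟨a₀, b₀, a₁, b₁, a₂, b₂, a₃, b₃⟩, 1 =>
    ⟨a₀, b₀, b₀ + a₂ - a₁, a₀ + b₀ + b₂ - b₁, a₂, b₂, a₃, b₃⟩
  | ⟨a₀, b₀, a₁, b₁, a₂, b₂, a₃, b₃⟩, 2 => ⟨a₀, b₀, a₁, b₁, a₁ + a₃ - a₂, b₁ + b₃ - b₂, a₃, b₃⟩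
  | ⟨a₀, b₀, a₁, b₁, a₂, b₂, a₃, b₃⟩, 3 => ⟨a₀, b₀, a₁, b₁, a₂, b₂, a₂ - a₃, b₂ - b₃⟩

/-- All coordinates are nonnegative. -/
def IntVec.isPos (v : IntVec) : Bool :=
  0 ≤ v.a₀ && 0 ≤ v.b₀ && 0 ≤ v.a₁ && 0 ≤ v.b₁ && 0 ≤ v.a₂ && 0 ≤ v.b₂ && 0 ≤ v.a₃ && 0 ≤ v.b₃

/-- All coordinates are nonpositive. -/
def IntVec.isNeg (v : IntVec) : Bool :=
  v.a₀ ≤ 0 && v.b₀ ≤ 0 && v.a₁ ≤ 0 && v.b₁ ≤ 0 && v.a₂ ≤ 0 && v.b₂ ≤ 0 && v.a₃ ≤ 0 && v.b₃ ≤ 0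

lemma toVec_intRoot (i : Fin 4) : (intRoot i).toVec = root i := by
  revert i; decide

lemma toVec_intRefl (v : IntVec) (i : Fin 4) : (intRefl v i).toVec = refl i v.toVec := by
  obtain ⟨a₀, b₀, a₁, b₁, a₂, b₂, a₃, b₃⟩ := v
  have h₁ : (2 : ZPhi).re = 2 := rfl
  have h₂ : (2 : ZPhi).im = 0 := rfl
  funext k
  fin_cases i <;> fin_cases k <;>
    simp [h₁, h₂, intRefl, IntVec.toVec, refl_apply, coroot, root, cartan, Fin.sum_univ_four,
      QuadraticAlgebra.ext_iff] <;> (try constructor) <;> ring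

lemma toVec_foldl (r : List (Fin 4)) (v : IntVec) :
    (r.foldl intRefl v).toVec = r.foldl (fun w i => refl i w) v.toVec := by
  induction r generalizing v with
  | nil => rfl
  | cons i r ih => rw [List.foldl_cons, List.foldl_cons, ih, toVec_intRefl]

lemma pos_of_isPos {v : IntVec} (h : v.isPos = true) : Pos v.toVec := by
  simp only [IntVec.isPos, Bool.and_eq_true, decide_eq_true_eq] at h
  intro k
  fin_cases k <;> simp [IntVec.toVec] <;> omega

lemma pos_neg_of_isNeg {v : IntVec} (h : v.isNeg = true) : Pos (-v.toVec) := by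
  simp only [IntVec.isNeg, Bool.and_eq_true, decide_eq_true_eq] at h
  intro k
  fin_cases k <;> simp [IntVec.toVec] <;> omega

/-- A sufficient condition for the reverse of a word to be reduced. -/
def checkReduced : List (Fin 4) → Bool
  | [] => true
  | s :: r => (r.foldl intRefl (intRoot s)).isPos && checkReduced r

/-- The reverse of a word for the longest element of `W_σ`. -/
def longWord (σ : Finset (Fin 4)) : List (Fin 4) :=
  if σ = {0, 1, 2, 3} then (List.replicate 15 [3, 2, 1, 0]).flatten
  else if σ = {0, 1, 2} then (List.replicate 5 [2, 1, 0]).flatten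
  else if σ = {1, 2, 3} then [1, 2, 1, 3, 2, 1]
  else if σ = {0, 1, 3} then [3, 0, 1, 0, 1, 0]
  else if σ = {0, 2, 3} then [0, 2, 3, 2]
  else if σ = {0, 1} then [0, 1, 0, 1, 0]
  else if σ = {1, 2} then [1, 2, 1]
  else if σ = {2, 3} then [2, 3, 2]
  else (List.finRange 4).filter (· ∈ σ)

lemma longWord_subset : ∀ σ : Finset (Fin 4), ∀ s ∈ longWord σ, s ∈ σ := by
  decide +kernel

lemma checkReduced_longWord : ∀ σ : Finset (Fin 4), checkReduced (longWord σ) = true := by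
  decide +kernel

lemma isNeg_longWord : ∀ σ : Finset (Fin 4), ∀ s ∈ σ,
    ((longWord σ).foldl intRefl (intRoot s)).isNeg = true := by
  decide +kernel

section Group

variable {W : Type*} [Group W] {Mat : CoxeterMatrix (Fin 4)} (cs : CoxeterSystem Mat W)
  (hM : ∀ i j, Mat i j = coxEntry i j)

lemma rep_wordProd_reverse (r : List (Fin 4)) (v : Fin 4 → ZPhi) :
    rep cs hM (cs.wordProd r.reverse) v = r.foldl (fun w i => refl i w) v := by
  induction r generalizing v with
  | nil => simp
  | cons i r ih =>
    rw [List.reverse_cons, wordProd_append, map_mul, Module.End.mul_apply, ih, wordProd_singleton,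
      rep_simple, List.foldl_cons]

include hM in
lemma length_of_checkReduced (r : List (Fin 4)) (h : checkReduced r = true) :
    cs.length (cs.wordProd r.reverse) = r.length := by
  induction r with
  | nil => simp
  | cons s r ih =>
    rw [checkReduced, Bool.and_eq_true] at h
    have h1 := pos_of_isPos h.1
    rw [toVec_foldl, toVec_intRoot, ← rep_wordProd_reverse cs hM, ← length_lt_iff cs hM] at h1
    have h2 := cs.length_mul_simple (cs.wordProd r.reverse) s
    have h3 := ih h.2
    rw [List.reverse_cons, wordProd_append, wordProd_singleton, List.length_cons]
    omega

include hM in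
lemma exists_longest (σ : Finset (Fin 4)) : ∃ x ∈ parabolic cs σ,
    cs.length x = (longWord σ).length ∧
      ∀ s ∈ σ, cs.length (x * cs.simple s) < cs.length x := by
  refine ⟨cs.wordProd (longWord σ).reverse, ?_,
    length_of_checkReduced cs hM _ (checkReduced_longWord σ), fun s hs => ?_⟩
  · refine list_prod_mem fun y hy => ?_
    obtain ⟨s, hs, rfl⟩ := List.mem_map.1 hy
    exact simple_mem_parabolic cs (longWord_subset σ s (List.mem_reverse.1 hs))
  · rw [length_gt_iff cs hM, rep_wordProd_reverse, ← toVec_intRoot, ← toVec_foldl]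
    exact pos_neg_of_isNeg (isNeg_longWord σ s hs)

end Group

/-! ### Polynomials given by lists of integer coefficients -/

/-- The value at `x` of the polynomial with the given list of coefficients. -/
def listEval {A : Type*} [CommRing A] (x : A) : List ℤ → A
  | [] => 0
  | a :: l => (a : A) + x * listEval x l

/-- Addition of coefficient lists. -/
def listAdd : List ℤ → List ℤ → List ℤ
  | [], m => m
  | l, [] => l
  | a :: l, b :: m => (a + b) :: listAdd l m

/-- Scalar multiplication of coefficient lists. -/
def listSMul (c : ℤ) : List ℤ → List ℤ
  | [] => []
  | a :: l => (c * a) :: listSMul c l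

/-- Multiplication of coefficient lists. -/
def listMul : List ℤ → List ℤ → List ℤ
  | [], _ => []
  | a :: l, m => listAdd (listSMul a m) (0 :: listMul l m)

/-- Powers of coefficient lists. -/
def listPow (l : List ℤ) : ℕ → List ℤ
  | 0 => [1]
  | n + 1 => listMul l (listPow l n)

/-- Whether two coefficient lists define the same polynomial. -/
def listEq (l m : List ℤ) : Bool := (listAdd l (listSMul (-1) m)).all (· == 0)

section ListEval

variable {A : Type*} [CommRing A] (x : A)

lemma listEval_add (l m : List ℤ) :
    listEval x (listAdd l m) = listEval x l + listEval x m := by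
  fun_induction listAdd l m with
  | case1 => simp [listEval]
  | case2 => simp [listEval]
  | case3 a l b m ih => simp only [listEval, ih]; push_cast; ring

lemma listEval_smul (c : ℤ) (l : List ℤ) : listEval x (listSMul c l) = c * listEval x l := by
  induction l with
  | nil => simp [listEval, listSMul]
  | cons a l ih => simp only [listEval, listSMul, ih]; push_cast; ring

lemma listEval_mul (l m : List ℤ) :
    listEval x (listMul l m) = listEval x l * listEval x m := by
  induction l with
  | nil => simp [listEval, listMul]
  | cons a l ih =>
    simp only [listEval, listMul, listEval_add, listEval_smul, ih]; push_cast; ring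

lemma listEval_pow (l : List ℤ) (n : ℕ) : listEval x (listPow l n) = listEval x l ^ n := by
  induction n with
  | zero => simp [listEval, listPow]
  | succ n ih => rw [listPow, listEval_mul, ih, pow_succ']

lemma listEval_eq_zero (l : List ℤ) (h : l.all (· == 0) = true) : listEval x l = 0 := by
  induction l with
  | nil => rfl
  | cons a l ih =>
    simp only [List.all_cons, Bool.and_eq_true, beq_iff_eq] at h
    rw [listEval, h.1, ih h.2]; simp

lemma listEval_eq {l m : List ℤ} (h : listEq l m = true) : listEval x l = listEval x m := by
  have h1 := listEval_eq_zero x _ h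
  rw [listEval_add, listEval_smul] at h1
  push_cast at h1
  linear_combination h1

end ListEval

/-! ### Cyclotomic polynomials -/

/-- The indices of the cyclotomic polynomials dividing the Poincaré polynomial of `H₄`. -/
def cycIndex : Fin 10 → ℕ := ![2, 3, 4, 5, 6, 10, 12, 15, 20, 30]

/-- The coefficients of the cyclotomic polynomials with index in `cycIndex`. -/
def cycCoeffs : Fin 10 → List ℤ :=
  ![[1, 1], [1, 1, 1], [1, 0, 1], [1, 1, 1, 1, 1], [1, -1, 1], [1, -1, 1, -1, 1],
    [1, 0, -1, 0, 1], [1, -1, 0, 1, -1, 1, 0, -1, 1], [1, 0, -1, 0, 1, 0, -1, 0, 1],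
    [1, 1, 0, -1, -1, -1, 0, 1, 1]]

lemma cyclotomic_eq_listEval (i : Fin 10) :
    cyclotomic (cycIndex i) ℚ = listEval X (cycCoeffs i) := by
  have d4 : Nat.properDivisors 4 = {1, 2} := by decide
  have d6 : Nat.properDivisors 6 = {1, 2, 3} := by decide
  have d10 : Nat.properDivisors 10 = {1, 2, 5} := by decide
  have d12 : Nat.properDivisors 12 = {1, 2, 3, 4, 6} := by decide
  have d15 : Nat.properDivisors 15 = {1, 3, 5} := by decide
  have d20 : Nat.properDivisors 20 = {1, 2, 4, 5, 10} := by decide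
  have d30 : Nat.properDivisors 30 = {1, 2, 3, 5, 6, 10, 15} := by decide
  have h2 : cyclotomic 2 ℚ = X + 1 := cyclotomic_two ℚ
  have h3 : cyclotomic 3 ℚ = X ^ 2 + X + 1 := cyclotomic_three ℚ
  have h5 : cyclotomic 5 ℚ = X ^ 4 + X ^ 3 + X ^ 2 + X + 1 := by
    have : Fact (Nat.Prime 5) := ⟨by norm_num⟩
    rw [cyclotomic_prime]; simp [Finset.sum_range_succ]; ring
  have h4 : cyclotomic 4 ℚ = X ^ 2 + 1 := by
    symm; rw [eq_cyclotomic_iff (by norm_num), d4]; simp [h2]; ring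
  have h6 : cyclotomic 6 ℚ = X ^ 2 - X + 1 := by
    symm; rw [eq_cyclotomic_iff (by norm_num), d6]; simp [h2, h3]; ring
  have h10 : cyclotomic 10 ℚ = X ^ 4 - X ^ 3 + X ^ 2 - X + 1 := by
    symm; rw [eq_cyclotomic_iff (by norm_num), d10]; simp [h2, h5]; ring
  have h12 : cyclotomic 12 ℚ = X ^ 4 - X ^ 2 + 1 := by
    symm; rw [eq_cyclotomic_iff (by norm_num), d12]; simp [h2, h3, h4, h6]; ring
  have h15 : cyclotomic 15 ℚ = X ^ 8 - X ^ 7 + X ^ 5 - X ^ 4 + X ^ 3 - X + 1 := by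
    symm; rw [eq_cyclotomic_iff (by norm_num), d15]; simp [h3, h5]; ring
  have h20 : cyclotomic 20 ℚ = X ^ 8 - X ^ 6 + X ^ 4 - X ^ 2 + 1 := by
    symm; rw [eq_cyclotomic_iff (by norm_num), d20]; simp [h2, h4, h5, h10]; ring
  have h30 : cyclotomic 30 ℚ = X ^ 8 + X ^ 7 - X ^ 5 - X ^ 4 - X ^ 3 + X + 1 := by
    symm; rw [eq_cyclotomic_iff (by norm_num), d30]; simp [h2, h3, h5, h6, h10, h15]; ring
  fin_cases i <;>
    simp [cycIndex, cycCoeffs, listEval, h2, h3, h4, h5, h6, h10, h12, h15, h20, h30] <;> ring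

/-- The product of the cyclotomic polynomials with the given exponents. -/
noncomputable def cycProd (e : Fin 10 → ℕ) : ℚ[X] := ∏ i, cyclotomic (cycIndex i) ℚ ^ e i

/-- The coefficients of `cycProd e`. -/
def cycProdCoeffs (e : Fin 10 → ℕ) : List ℤ :=
  (List.finRange 10).foldr (fun i l => listMul (listPow (cycCoeffs i) (e i)) l) [1]

lemma cycProd_eq_listEval (e : Fin 10 → ℕ) : cycProd e = listEval X (cycProdCoeffs e) := by
  have h : ∀ L : List (Fin 10), (L.map fun i => cyclotomic (cycIndex i) ℚ ^ e i).prod =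
      listEval X (L.foldr (fun i l => listMul (listPow (cycCoeffs i) (e i)) l) [1]) := by
    intro L
    induction L with
    | nil => simp [listEval]
    | cons i L ih =>
      rw [List.map_cons, List.prod_cons, ih, List.foldr_cons, listEval_mul, listEval_pow,
        cyclotomic_eq_listEval]
  rw [cycProdCoeffs, ← h, cycProd, Fin.prod_univ_def]

lemma cycProd_mul (e e' : Fin 10 → ℕ) : cycProd e * cycProd e' = cycProd (e + e') := by
  simp [cycProd, pow_add, Finset.prod_mul_distrib]

lemma cycProd_ne_zero (e : Fin 10 → ℕ) : cycProd e ≠ 0 :=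
  Finset.prod_ne_zero_iff.2 fun _ _ => pow_ne_zero _ (cyclotomic_ne_zero _ ℚ)

/-- The exponents of the cyclotomic polynomials in the Poincaré polynomial of `W_σ`. -/
def poinExp (σ : Finset (Fin 4)) : Fin 10 → ℕ :=
  if σ = {0, 1, 2, 3} then ![4, 2, 2, 2, 2, 2, 1, 1, 1, 1]
  else if σ = {0, 1, 2} then ![3, 1, 0, 1, 1, 1, 0, 0, 0, 0]
  else if σ = {1, 2, 3} then ![2, 1, 1, 0, 0, 0, 0, 0, 0, 0]
  else if σ = {0, 1, 3} then ![2, 0, 0, 1, 0, 0, 0, 0, 0, 0]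
  else if σ = {0, 2, 3} then ![2, 1, 0, 0, 0, 0, 0, 0, 0, 0]
  else if σ = {0, 1} then ![1, 0, 0, 1, 0, 0, 0, 0, 0, 0]
  else if σ = {1, 2} then ![1, 1, 0, 0, 0, 0, 0, 0, 0, 0]
  else if σ = {2, 3} then ![1, 1, 0, 0, 0, 0, 0, 0, 0, 0]
  else ![σ.card, 0, 0, 0, 0, 0, 0, 0, 0, 0]

lemma poinExp_mono : ∀ σ τ : Finset (Fin 4), τ ⊆ σ → ∀ i, poinExp τ i ≤ poinExp σ i := by
  decide +kernel

/-- The subsets of `Fin 4`, as a list. -/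
def subsetList : List (Finset (Fin 4)) :=
  (List.finRange 4).sublists.map List.toFinset

lemma powerset_eq : ∀ σ : Finset (Fin 4),
    σ.powerset = (subsetList.filter (· ⊆ σ)).toFinset := by
  decide +kernel

lemma subsetList_nodup : subsetList.Nodup := by decide +kernel

/-- The coefficients of `∑_{J ⊆ σ} (-1)^|J| W_σ(q) / W_J(q)`. -/
def altSumCoeffs (σ : Finset (Fin 4)) : List ℤ :=
  (subsetList.filter (· ⊆ σ)).foldr
    (fun J l => listAdd (listSMul ((-1) ^ J.card) (cycProdCoeffs (poinExp σ - poinExp J))) l) []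

lemma altSumCoeffs_eq : ∀ σ : Finset (Fin 4),
    listEq (altSumCoeffs σ) (listPow [0, 1] (longWord σ).length) = true := by
  decide +kernel

lemma altSum_eq (σ : Finset (Fin 4)) :
    ∑ J ∈ σ.powerset, (-1) ^ J.card * cycProd (poinExp σ - poinExp J) =
      X ^ (longWord σ).length := by
  rw [powerset_eq, List.sum_toFinset _ (subsetList_nodup.filter _)]
  have h : ∀ L : List (Finset (Fin 4)),
      (L.map fun J => (-1) ^ J.card * cycProd (poinExp σ - poinExp J)).sum =
      listEval X (L.foldr (fun J l =>
        listAdd (listSMul ((-1) ^ J.card) (cycProdCoeffs (poinExp σ - poinExp J))) l) []) := by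
    intro L
    induction L with
    | nil => simp [listEval]
    | cons J L ih =>
      rw [List.map_cons, List.sum_cons, ih, List.foldr_cons, listEval_add, listEval_smul,
        cycProd_eq_listEval]
      push_cast
      rfl
  rw [h, ← altSumCoeffs, listEval_eq X (altSumCoeffs_eq σ), listEval_pow]
  simp [listEval]

lemma longWord_length_ne_zero : ∀ σ : Finset (Fin 4), σ.Nonempty → (longWord σ).length ≠ 0 := by
  decide +kernel

section Group

variable {W : Type*} [Group W] {Mat : CoxeterMatrix (Fin 4)} (cs : CoxeterSystem Mat W)
  (hM : ∀ i j, Mat i j = coxEntry i j)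

include hM in
lemma finite_parabolic (σ : Finset (Fin 4)) : (parabolic cs σ : Set W).Finite := by
  obtain ⟨x, -, -, hx⟩ := exists_longest cs hM σ
  exact parabolic_finite cs hM hx

include hM in
lemma poin_ne_zero (σ : Finset (Fin 4)) : poin cs σ ≠ 0 := by
  have h := finite_parabolic cs hM σ
  intro h0
  have h1 := congrArg (eval 1) h0
  rw [poin_eq_sum cs h, eval_finsetSum] at h1
  simp only [eval_pow, eval_X, one_pow, Finset.sum_const, eval_zero, nsmul_eq_mul, mul_one,
    Nat.cast_eq_zero, Finset.card_eq_zero] at h1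
  have h2 : (1 : W) ∈ h.toFinset := by simp
  rw [h1] at h2
  simp at h2

include hM in
theorem poin_eq (σ : Finset (Fin 4)) : poin cs σ = cycProd (poinExp σ) := by
  induction σ using Finset.strongInduction with
  | H σ ih =>
  obtain ⟨x, hx', hl, hx⟩ := exists_longest cs hM σ
  have h := finite_parabolic cs hM σ
  have hsum := sum_cosetPoin cs hM h hx' hx
  have halt := altSum_eq σ
  rw [hl] at hsum
  have hself : cosetPoin cs h σ = 1 := by
    have := poin_eq_mul_cosetPoin cs hM h (Finset.Subset.refl σ)
    exact (mul_right_eq_self₀.1 this.symm).resolve_right (poin_ne_zero cs hM σ)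
  rcases σ.eq_empty_or_nonempty with rfl | hne
  · have h1 := poin_eq_mul_cosetPoin cs hM h (Finset.Subset.refl ∅)
    have h2 : poin cs ∅ = cosetPoin cs h ∅ := by
      rw [poin_eq_sum cs h, cosetPoin]; simp
    have h3 : poinExp ∅ = 0 := by decide
    rw [h2, hself, h3]
    simp [cycProd]
  have hterm : ∀ J ∈ σ.ssubsets, cycProd (poinExp σ) * cosetPoin cs h J =
      poin cs σ * cycProd (poinExp σ - poinExp J) := by
    intro J hJ
    rw [Finset.mem_ssubsets] at hJ
    have h1 : cycProd (poinExp J) * cycProd (poinExp σ - poinExp J) = cycProd (poinExp σ) := by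
      rw [cycProd_mul]
      congr 1
      funext i
      have := poinExp_mono σ J hJ.subset i
      simp only [Pi.add_apply, Pi.sub_apply]
      omega
    rw [poin_eq_mul_cosetPoin cs hM h hJ.subset, ih J hJ, ← h1]
    ring
  rw [← Finset.insert_erase (Finset.mem_powerset_self σ),
    Finset.sum_insert (Finset.notMem_erase _ _)] at hsum halt
  rw [hself] at hsum
  have h0 : cycProd (poinExp σ - poinExp σ) = 1 := by simp [cycProd]
  rw [h0] at halt
  have hrest : cycProd (poinExp σ) * ∑ J ∈ σ.powerset.erase σ, (-1) ^ J.card * cosetPoin cs h J =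
      poin cs σ * ∑ J ∈ σ.powerset.erase σ, (-1) ^ J.card * cycProd (poinExp σ - poinExp J) := by
    rw [Finset.mul_sum, Finset.mul_sum]
    refine Finset.sum_congr rfl fun J hJ => ?_
    have := hterm J hJ
    linear_combination (-1) ^ J.card * this
  have hN : (longWord σ).length ≠ 0 := longWord_length_ne_zero σ hne
  have hX : (X : ℚ[X]) ^ (longWord σ).length - (-1) ^ σ.card ≠ 0 := by
    intro h1
    have h2 := congrArg (eval 0) h1
    rcases neg_one_pow_eq_or ℚ[X] σ.card with h3 | h3 <;> rw [h3] at h2 <;> simp [hN] at h2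
  apply mul_left_cancel₀ hX
  linear_combination cycProd (poinExp σ) * hsum - poin cs σ * halt - hrest

end Group

/-! ### The weighted complex of type `H₄` -/

section Complex

variable {W : Type*} [Group W] {Mat : CoxeterMatrix (Fin 4)} (cs : CoxeterSystem Mat W)
  (hM : ∀ i j, Mat i j = coxEntry i j)

include hM in
lemma bcoeff_insert {τ : Finset (Fin 4)} {s : Fin 4} (hs : s ∉ τ) :
    bcoeff cs (insert s τ) τ = (-1) ^ (τ.filter (· < s)).card *
      toLaurent (cycProd (poinExp (insert s τ) - poinExp τ)) := by
  have h1 : cycProd (poinExp τ) * cycProd (poinExp (insert s τ) - poinExp τ) =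
      cycProd (poinExp (insert s τ)) := by
    rw [cycProd_mul]
    congr 1
    funext i
    have := poinExp_mono (insert s τ) τ (Finset.subset_insert s τ) i
    simp only [Pi.add_apply, Pi.sub_apply]
    omega
  have h2 : poin cs (insert s τ) / poin cs τ =
      cycProd (poinExp (insert s τ) - poinExp τ) := by
    rw [poin_eq cs hM, poin_eq cs hM, ← h1, mul_div_cancel_left₀ _ (cycProd_ne_zero _)]
  have h3 : ∀ t ∈ insert s τ, τ = (insert s τ).erase t ↔ t = s := by
    intro t ht
    constructor
    · intro h
      by_contra hts
      have : s ∈ (insert s τ).erase t := Finset.mem_erase.2 ⟨Ne.symm hts, Finset.mem_insert_self s τ⟩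
      exact hs (h ▸ this)
    · rintro rfl
      exact (Finset.erase_insert hs).symm
  rw [bcoeff, Finset.sum_eq_single_of_mem s (Finset.mem_insert_self s τ)
    fun t ht hts => if_neg fun h => hts ((h3 t ht).1 h),
    if_pos ((h3 s (Finset.mem_insert_self s τ)).2 rfl), h2, Finset.filter_insert,
    if_neg (lt_irrefl s)]

lemma bcoeff_eq_zero {σ τ : Finset (Fin 4)} (h : ∀ s ∉ τ, σ ≠ insert s τ) :
    bcoeff cs σ τ = 0 := by
  refine Finset.sum_eq_zero fun s hs => if_neg ?_
  rintro rfl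
  exact h s (Finset.notMem_erase s σ) (Finset.insert_erase hs).symm

/-- The boundary map of the weighted complex, extended to functions on all subsets. -/
noncomputable def bd (y : Finset (Fin 4) → R) (τ : Finset (Fin 4)) : R :=
  ∑ s ∈ τᶜ, (-1) ^ (τ.filter (· < s)).card *
    toLaurent (cycProd (poinExp (insert s τ) - poinExp τ)) * y (insert s τ)

include hM in
lemma bdry_apply (k : ℕ) (y : Finset (Fin 4) → R) (τ : KW cs k) :
    bdry cs k (fun σ => y σ.1) τ = bd y τ.1 := by
  have h0 : bdry cs k (fun σ => y σ.1) τ =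
      ∑ σ : KW cs (k + 1), bcoeff cs σ.1 τ.1 * y σ.1 := rfl
  rw [h0, ← Finset.sum_subtype (Finset.univ.filter fun σ : Finset (Fin 4) => σ.card = k + 1)
    (fun σ => by simp [finite_parabolic cs hM σ]) fun σ => bcoeff cs σ τ.1 * y σ,
    ← Finset.sum_subset (s₁ := (τ.1)ᶜ.image fun s => insert s τ.1), Finset.sum_image, bd]
  · refine Finset.sum_congr rfl fun s hs => ?_
    rw [bcoeff_insert cs hM (Finset.mem_compl.1 hs)]
  · exact (Finset.insert_inj_on τ.1).mono fun s hs => by simpa using hs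
  · intro σ hσ
    obtain ⟨s, hs, rfl⟩ := Finset.mem_image.1 hσ
    simp [Finset.card_insert_of_notMem (Finset.mem_compl.1 hs), τ.2.1]
  · intro σ _ hσ
    rw [bcoeff_eq_zero, zero_mul]
    rintro s hs rfl
    exact hσ (Finset.mem_image_of_mem _ (Finset.mem_compl.2 hs))

end Complex

lemma toLaurent_cycProd (e : Fin 10 → ℕ) :
    toLaurent (cycProd e) = ∏ i, cyc (cycIndex i) ^ e i := by
  simp [cycProd, cyc]

lemma bd_term (y : Finset (Fin 4) → R) {τ : Finset (Fin 4)} {s : Fin 4} (σ : Finset (Fin 4))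
    (n : ℕ) (e : Fin 10 → ℕ) (hσ : insert s τ = σ) (hn : (τ.filter (· < s)).card = n)
    (he : poinExp σ - poinExp τ = e) :
    (-1) ^ (τ.filter (· < s)).card *
      toLaurent (cycProd (poinExp (insert s τ) - poinExp τ)) * y (insert s τ) =
      (-1) ^ n * (∏ i, cyc (cycIndex i) ^ e i) * y σ := by
  rw [hσ, hn, he, toLaurent_cycProd]

lemma bd_empty (y : Finset (Fin 4) → R) : bd y ∅ =
    cyc 2 * y {0} + cyc 2 * y {1} + cyc 2 * y {2} + cyc 2 * y {3} := by
  rw [bd, show (∅ : Finset (Fin 4))ᶜ = {0, 1, 2, 3} by decide,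
    Finset.sum_insert (by decide), Finset.sum_insert (by decide),
    Finset.sum_pair (by decide),
    bd_term y {0} 0 ![1, 0, 0, 0, 0, 0, 0, 0, 0, 0] (by decide) (by decide) (by decide),
    bd_term y {1} 0 ![1, 0, 0, 0, 0, 0, 0, 0, 0, 0] (by decide) (by decide) (by decide),
    bd_term y {2} 0 ![1, 0, 0, 0, 0, 0, 0, 0, 0, 0] (by decide) (by decide) (by decide),
    bd_term y {3} 0 ![1, 0, 0, 0, 0, 0, 0, 0, 0, 0] (by decide) (by decide) (by decide)]
  simp only [Fin.prod_univ_succ, cycIndex, Fin.prod_univ_zero,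
    Matrix.cons_val_succ, Matrix.cons_val_zero]
  ring

lemma bd_0 (y : Finset (Fin 4) → R) : bd y {0} =
    -(cyc 5 * y {0, 1}) - cyc 2 * y {0, 2} - cyc 2 * y {0, 3} := by
  rw [bd, show ({0} : Finset (Fin 4))ᶜ = {1, 2, 3} by decide,
    Finset.sum_insert (by decide), Finset.sum_pair (by decide),
    bd_term y {0, 1} 1 ![0, 0, 0, 1, 0, 0, 0, 0, 0, 0] (by decide) (by decide) (by decide),
    bd_term y {0, 2} 1 ![1, 0, 0, 0, 0, 0, 0, 0, 0, 0] (by decide) (by decide) (by decide),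
    bd_term y {0, 3} 1 ![1, 0, 0, 0, 0, 0, 0, 0, 0, 0] (by decide) (by decide) (by decide)]
  simp only [Fin.prod_univ_succ, cycIndex, Fin.prod_univ_zero,
    Matrix.cons_val_succ, Matrix.cons_val_zero]
  ring

lemma bd_1 (y : Finset (Fin 4) → R) : bd y {1} =
    cyc 5 * y {0, 1} - cyc 3 * y {1, 2} - cyc 2 * y {1, 3} := by
  rw [bd, show ({1} : Finset (Fin 4))ᶜ = {0, 2, 3} by decide,
    Finset.sum_insert (by decide), Finset.sum_pair (by decide),
    bd_term y {0, 1} 0 ![0, 0, 0, 1, 0, 0, 0, 0, 0, 0] (by decide) (by decide) (by decide),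
    bd_term y {1, 2} 1 ![0, 1, 0, 0, 0, 0, 0, 0, 0, 0] (by decide) (by decide) (by decide),
    bd_term y {1, 3} 1 ![1, 0, 0, 0, 0, 0, 0, 0, 0, 0] (by decide) (by decide) (by decide)]
  simp only [Fin.prod_univ_succ, cycIndex, Fin.prod_univ_zero,
    Matrix.cons_val_succ, Matrix.cons_val_zero]
  ring

lemma bd_2 (y : Finset (Fin 4) → R) : bd y {2} =
    cyc 2 * y {0, 2} + cyc 3 * y {1, 2} - cyc 3 * y {2, 3} := by
  rw [bd, show ({2} : Finset (Fin 4))ᶜ = {0, 1, 3} by decide,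
    Finset.sum_insert (by decide), Finset.sum_pair (by decide),
    bd_term y {0, 2} 0 ![1, 0, 0, 0, 0, 0, 0, 0, 0, 0] (by decide) (by decide) (by decide),
    bd_term y {1, 2} 0 ![0, 1, 0, 0, 0, 0, 0, 0, 0, 0] (by decide) (by decide) (by decide),
    bd_term y {2, 3} 1 ![0, 1, 0, 0, 0, 0, 0, 0, 0, 0] (by decide) (by decide) (by decide)]
  simp only [Fin.prod_univ_succ, cycIndex, Fin.prod_univ_zero,
    Matrix.cons_val_succ, Matrix.cons_val_zero]
  ring

lemma bd_3 (y : Finset (Fin 4) → R) : bd y {3} =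
    cyc 2 * y {0, 3} + cyc 2 * y {1, 3} + cyc 3 * y {2, 3} := by
  rw [bd, show ({3} : Finset (Fin 4))ᶜ = {0, 1, 2} by decide,
    Finset.sum_insert (by decide), Finset.sum_pair (by decide),
    bd_term y {0, 3} 0 ![1, 0, 0, 0, 0, 0, 0, 0, 0, 0] (by decide) (by decide) (by decide),
    bd_term y {1, 3} 0 ![1, 0, 0, 0, 0, 0, 0, 0, 0, 0] (by decide) (by decide) (by decide),
    bd_term y {2, 3} 0 ![0, 1, 0, 0, 0, 0, 0, 0, 0, 0] (by decide) (by decide) (by decide)]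
  simp only [Fin.prod_univ_succ, cycIndex, Fin.prod_univ_zero,
    Matrix.cons_val_succ, Matrix.cons_val_zero]
  ring

lemma bd_01 (y : Finset (Fin 4) → R) : bd y {0, 1} =
    cyc 2 ^ 2 * cyc 3 * cyc 6 * cyc 10 * y {0, 1, 2} + cyc 2 * y {0, 1, 3} := by
  rw [bd, show ({0, 1} : Finset (Fin 4))ᶜ = {2, 3} by decide,
    Finset.sum_pair (by decide),
    bd_term y {0, 1, 2} 2 ![2, 1, 0, 0, 1, 1, 0, 0, 0, 0] (by decide) (by decide) (by decide),
    bd_term y {0, 1, 3} 2 ![1, 0, 0, 0, 0, 0, 0, 0, 0, 0] (by decide) (by decide) (by decide)]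
  simp only [Fin.prod_univ_succ, cycIndex, Fin.prod_univ_zero,
    Matrix.cons_val_succ, Matrix.cons_val_zero]
  ring

lemma bd_02 (y : Finset (Fin 4) → R) : bd y {0, 2} =
    -(cyc 2 * cyc 3 * cyc 5 * cyc 6 * cyc 10 * y {0, 1, 2}) + cyc 3 * y {0, 2, 3} := by
  rw [bd, show ({0, 2} : Finset (Fin 4))ᶜ = {1, 3} by decide,
    Finset.sum_pair (by decide),
    bd_term y {0, 1, 2} 1 ![1, 1, 0, 1, 1, 1, 0, 0, 0, 0] (by decide) (by decide) (by decide),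
    bd_term y {0, 2, 3} 2 ![0, 1, 0, 0, 0, 0, 0, 0, 0, 0] (by decide) (by decide) (by decide)]
  simp only [Fin.prod_univ_succ, cycIndex, Fin.prod_univ_zero,
    Matrix.cons_val_succ, Matrix.cons_val_zero]
  ring

lemma bd_03 (y : Finset (Fin 4) → R) : bd y {0, 3} =
    -(cyc 5 * y {0, 1, 3}) - cyc 3 * y {0, 2, 3} := by
  rw [bd, show ({0, 3} : Finset (Fin 4))ᶜ = {1, 2} by decide,
    Finset.sum_pair (by decide),
    bd_term y {0, 1, 3} 1 ![0, 0, 0, 1, 0, 0, 0, 0, 0, 0] (by decide) (by decide) (by decide),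
    bd_term y {0, 2, 3} 1 ![0, 1, 0, 0, 0, 0, 0, 0, 0, 0] (by decide) (by decide) (by decide)]
  simp only [Fin.prod_univ_succ, cycIndex, Fin.prod_univ_zero,
    Matrix.cons_val_succ, Matrix.cons_val_zero]
  ring

lemma bd_12 (y : Finset (Fin 4) → R) : bd y {1, 2} =
    cyc 2 ^ 2 * cyc 5 * cyc 6 * cyc 10 * y {0, 1, 2} + cyc 2 * cyc 4 * y {1, 2, 3} := by
  rw [bd, show ({1, 2} : Finset (Fin 4))ᶜ = {0, 3} by decide,
    Finset.sum_pair (by decide),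
    bd_term y {0, 1, 2} 0 ![2, 0, 0, 1, 1, 1, 0, 0, 0, 0] (by decide) (by decide) (by decide),
    bd_term y {1, 2, 3} 2 ![1, 0, 1, 0, 0, 0, 0, 0, 0, 0] (by decide) (by decide) (by decide)]
  simp only [Fin.prod_univ_succ, cycIndex, Fin.prod_univ_zero,
    Matrix.cons_val_succ, Matrix.cons_val_zero]
  ring

lemma bd_13 (y : Finset (Fin 4) → R) : bd y {1, 3} =
    cyc 5 * y {0, 1, 3} - cyc 3 * cyc 4 * y {1, 2, 3} := by
  rw [bd, show ({1, 3} : Finset (Fin 4))ᶜ = {0, 2} by decide,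
    Finset.sum_pair (by decide),
    bd_term y {0, 1, 3} 0 ![0, 0, 0, 1, 0, 0, 0, 0, 0, 0] (by decide) (by decide) (by decide),
    bd_term y {1, 2, 3} 1 ![0, 1, 1, 0, 0, 0, 0, 0, 0, 0] (by decide) (by decide) (by decide)]
  simp only [Fin.prod_univ_succ, cycIndex, Fin.prod_univ_zero,
    Matrix.cons_val_succ, Matrix.cons_val_zero]
  ring

lemma bd_23 (y : Finset (Fin 4) → R) : bd y {2, 3} =
    cyc 2 * y {0, 2, 3} + cyc 2 * cyc 4 * y {1, 2, 3} := by
  rw [bd, show ({2, 3} : Finset (Fin 4))ᶜ = {0, 1} by decide,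
    Finset.sum_pair (by decide),
    bd_term y {0, 2, 3} 0 ![1, 0, 0, 0, 0, 0, 0, 0, 0, 0] (by decide) (by decide) (by decide),
    bd_term y {1, 2, 3} 0 ![1, 0, 1, 0, 0, 0, 0, 0, 0, 0] (by decide) (by decide) (by decide)]
  simp only [Fin.prod_univ_succ, cycIndex, Fin.prod_univ_zero,
    Matrix.cons_val_succ, Matrix.cons_val_zero]
  ring

lemma bd_012 (y : Finset (Fin 4) → R) : bd y {0, 1, 2} =
    -(cyc 2 * cyc 3 * cyc 4 ^ 2 * cyc 5 * cyc 6 * cyc 10 * cyc 12 * cyc 15 * cyc 20 * cyc 30 * y {0, 1, 2, 3}) := by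
  rw [bd, show ({0, 1, 2} : Finset (Fin 4))ᶜ = {3} by decide,
    Finset.sum_singleton,
    bd_term y {0, 1, 2, 3} 3 ![1, 1, 2, 1, 1, 1, 1, 1, 1, 1] (by decide) (by decide) (by decide)]
  simp only [Fin.prod_univ_succ, cycIndex, Fin.prod_univ_zero,
    Matrix.cons_val_succ, Matrix.cons_val_zero]
  ring

lemma bd_013 (y : Finset (Fin 4) → R) : bd y {0, 1, 3} =
    cyc 2 ^ 2 * cyc 3 ^ 2 * cyc 4 ^ 2 * cyc 5 * cyc 6 ^ 2 * cyc 10 ^ 2 * cyc 12 * cyc 15 * cyc 20 * cyc 30 * y {0, 1, 2, 3} := by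
  rw [bd, show ({0, 1, 3} : Finset (Fin 4))ᶜ = {2} by decide,
    Finset.sum_singleton,
    bd_term y {0, 1, 2, 3} 2 ![2, 2, 2, 1, 2, 2, 1, 1, 1, 1] (by decide) (by decide) (by decide)]
  simp only [Fin.prod_univ_succ, cycIndex, Fin.prod_univ_zero,
    Matrix.cons_val_succ, Matrix.cons_val_zero]
  ring

lemma bd_023 (y : Finset (Fin 4) → R) : bd y {0, 2, 3} =
    -(cyc 2 ^ 2 * cyc 3 * cyc 4 ^ 2 * cyc 5 ^ 2 * cyc 6 ^ 2 * cyc 10 ^ 2 * cyc 12 * cyc 15 * cyc 20 * cyc 30 * y {0, 1, 2, 3}) := by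
  rw [bd, show ({0, 2, 3} : Finset (Fin 4))ᶜ = {1} by decide,
    Finset.sum_singleton,
    bd_term y {0, 1, 2, 3} 1 ![2, 1, 2, 2, 2, 2, 1, 1, 1, 1] (by decide) (by decide) (by decide)]
  simp only [Fin.prod_univ_succ, cycIndex, Fin.prod_univ_zero,
    Matrix.cons_val_succ, Matrix.cons_val_zero]
  ring

lemma bd_123 (y : Finset (Fin 4) → R) : bd y {1, 2, 3} =
    cyc 2 ^ 2 * cyc 3 * cyc 4 * cyc 5 ^ 2 * cyc 6 ^ 2 * cyc 10 ^ 2 * cyc 12 * cyc 15 * cyc 20 * cyc 30 * y {0, 1, 2, 3} := by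
  rw [bd, show ({1, 2, 3} : Finset (Fin 4))ᶜ = {0} by decide,
    Finset.sum_singleton,
    bd_term y {0, 1, 2, 3} 0 ![2, 1, 1, 2, 2, 2, 1, 1, 1, 1] (by decide) (by decide) (by decide)]
  simp only [Fin.prod_univ_succ, cycIndex, Fin.prod_univ_zero,
    Matrix.cons_val_succ, Matrix.cons_val_zero]
  ring

/-! ### Exactness -/

lemma exists_fun_pairs (a b c d e f : R) : ∃ z : Finset (Fin 4) → R,
    z {0, 1} = a ∧ z {0, 2} = b ∧ z {0, 3} = c ∧ z {1, 2} = d ∧ z {1, 3} = e ∧ z {2, 3} = f :=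
  ⟨fun σ => if σ = {0, 1} then a else if σ = {0, 2} then b else if σ = {0, 3} then c
    else if σ = {1, 2} then d else if σ = {1, 3} then e else f, rfl, rfl, rfl, rfl, rfl, rfl⟩

lemma exists_fun_triples (a b c d : R) : ∃ z : Finset (Fin 4) → R,
    z {0, 1, 2} = a ∧ z {0, 1, 3} = b ∧ z {0, 2, 3} = c ∧ z {1, 2, 3} = d :=
  ⟨fun σ => if σ = {0, 1, 2} then a else if σ = {0, 1, 3} then b
    else if σ = {0, 2, 3} then c else d, rfl, rfl, rfl, rfl⟩

lemma eq_empty_of_card : ∀ σ : Finset (Fin 4), σ.card = 0 → σ = ∅ := by decide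

lemma eq_of_card_one : ∀ σ : Finset (Fin 4), σ.card = 1 →
    σ = {0} ∨ σ = {1} ∨ σ = {2} ∨ σ = {3} := by decide

lemma eq_of_card_two : ∀ σ : Finset (Fin 4), σ.card = 2 →
    σ = {0, 1} ∨ σ = {0, 2} ∨ σ = {0, 3} ∨ σ = {1, 2} ∨ σ = {1, 3} ∨ σ = {2, 3} := by decide

lemma eq_of_card_three : ∀ σ : Finset (Fin 4), σ.card = 3 →
    σ = {0, 1, 2} ∨ σ = {0, 1, 3} ∨ σ = {0, 2, 3} ∨ σ = {1, 2, 3} := by decide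

lemma eq_of_card_four : ∀ σ : Finset (Fin 4), σ.card = 4 → σ = {0, 1, 2, 3} := by decide

/-- The variable of `R`. -/
noncomputable def qv : R := LaurentPolynomial.T 1

lemma toLaurent_listEval (l : List ℤ) : toLaurent (listEval (X : ℚ[X]) l) = listEval qv l := by
  induction l with
  | nil => simp [listEval]
  | cons a l ih => simp [listEval, ih, qv]

lemma cyc_eq (i : Fin 10) : cyc (cycIndex i) = listEval qv (cycCoeffs i) := by
  rw [cyc, cyclotomic_eq_listEval, toLaurent_listEval]

lemma cyc_two : cyc 2 = 1 + qv := by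
  have := cyc_eq 0; simp [cycIndex, cycCoeffs, listEval] at this; rw [this]

lemma cyc_three : cyc 3 = qv * cyc 2 + 1 := by
  have := cyc_eq 1; simp [cycIndex, cycCoeffs, listEval] at this; rw [this, cyc_two]; ring

lemma cyc_five : cyc 5 = (qv + qv ^ 3) * cyc 2 + 1 := by
  have := cyc_eq 3; simp [cycIndex, cycCoeffs, listEval] at this; rw [this, cyc_two]; ring

lemma cyc_bezout : ∃ a b : R, a * cyc 4 + b * (cyc 2 * cyc 5 * cyc 6 * cyc 10) = 1 := by
  have h4 := cyc_eq 2
  have h6 := cyc_eq 4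
  have h10 := cyc_eq 5
  simp [cycIndex, cycCoeffs, listEval] at h4 h6 h10
  have h : (LaurentPolynomial.C 2⁻¹ : R) * 2 = 1 := by
    rw [← map_ofNat LaurentPolynomial.C, ← map_mul]; norm_num
  refine ⟨LaurentPolynomial.C 2⁻¹ * listEval qv [1, -1, -2, -1, 0, -1, -2, -1, 0, -1, -1],
    LaurentPolynomial.C 2⁻¹ * (1 + qv), ?_⟩
  rw [cyc_five, cyc_two, h4, h6, h10]
  simp [listEval]
  linear_combination h

lemma cyc_ne_zero (d : ℕ) : cyc d ≠ 0 := by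
  rw [cyc, Ne, ← map_zero (toLaurent (R := ℚ)), toLaurent_injective.eq_iff]
  exact cyclotomic_ne_zero d ℚ

lemma exact_one (y : Finset (Fin 4) → R) (h : bd y ∅ = 0) :
    ∃ z, ∀ σ : Finset (Fin 4), σ.card = 1 → bd z σ = y σ := by
  rw [bd_empty] at h
  have h' : y {0} + y {1} + y {2} + y {3} = 0 := by
    apply mul_left_cancel₀ (cyc_ne_zero 2)
    linear_combination h
  obtain ⟨z, h01, h02, h03, h12, h13, h23⟩ := exists_fun_pairs
    (y {1} + y {2} + y {3})
    (-qv * (y {2} + y {3}) + qv * y {3})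
    (-(qv + qv ^ 3) * (y {1} + y {2} + y {3}) + qv * (y {2} + y {3}) - qv * y {3})
    (y {2} + y {3})
    ((qv + qv ^ 3) * (y {1} + y {2} + y {3}) - qv * (y {2} + y {3}))
    (y {3})
  refine ⟨z, fun σ hσ => ?_⟩
  rcases eq_of_card_one σ hσ with rfl | rfl | rfl | rfl
  · rw [bd_0, h01, h02, h03, cyc_five]; linear_combination -h'
  · rw [bd_1, h01, h12, h13, cyc_five, cyc_three]; ring
  · rw [bd_2, h02, h12, h23, cyc_three]; ring
  · rw [bd_3, h03, h13, h23, cyc_three]; ring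

lemma exact_two (x : Finset (Fin 4) → R) (h : ∀ σ : Finset (Fin 4), σ.card = 1 → bd x σ = 0) :
    ∃ z, ∀ σ : Finset (Fin 4), σ.card = 2 → bd z σ = x σ := by
  have h0 := h {0} rfl
  have h1 := h {1} rfl
  have h2 := h {2} rfl
  have h3 := h {3} rfl
  rw [bd_0] at h0
  rw [bd_1] at h1
  rw [bd_2] at h2
  rw [bd_3] at h3
  have hA := cyc_ne_zero 2
  obtain ⟨a, b, hab⟩ := cyc_bezout
  have c3 := cyc_three
  have c5 := cyc_five
  obtain ⟨z23, e23⟩ : ∃ t, x {2, 3} = cyc 2 * t :=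
    ⟨-(x {0, 3} + x {1, 3} + qv * x {2, 3}), by linear_combination h3 - c3 * x {2, 3}⟩
  obtain ⟨z12, e12⟩ : ∃ t, x {1, 2} = cyc 2 * t :=
    ⟨z23 - (x {0, 2} + qv * (x {1, 2} - x {2, 3})), by
      linear_combination h2 - c3 * (x {1, 2} - x {2, 3}) + e23⟩
  obtain ⟨z01, e01⟩ : ∃ t, x {0, 1} = cyc 2 * t :=
    ⟨-(x {0, 2} + x {0, 3} + (qv + qv ^ 3) * x {0, 1}), by
      linear_combination -h0 - c5 * x {0, 1}⟩
  have g3 : x {0, 3} + x {1, 3} + cyc 3 * z23 = 0 := by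
    apply mul_left_cancel₀ hA
    linear_combination h3 - cyc 3 * e23
  have g2 : x {0, 2} + cyc 3 * (z12 - z23) = 0 := by
    apply mul_left_cancel₀ hA
    linear_combination h2 - cyc 3 * e12 + cyc 3 * e23
  have g0 : cyc 5 * z01 + x {0, 2} + x {0, 3} = 0 := by
    apply mul_left_cancel₀ hA
    linear_combination -h0 - cyc 5 * e01
  obtain ⟨y, y012, y013, y023, y123⟩ := exists_fun_triples (b * z12)
    (z01 - cyc 2 * cyc 3 * cyc 6 * cyc 10 * (b * z12)) (z23 - cyc 4 * (a * z12)) (a * z12)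
  refine ⟨y, fun σ hσ => ?_⟩
  rcases eq_of_card_two σ hσ with rfl | rfl | rfl | rfl | rfl | rfl
  · rw [bd_01, y012, y013]; linear_combination -e01
  · rw [bd_02, y012, y023]; linear_combination -g2 - cyc 3 * z12 * hab
  · rw [bd_03, y013, y023]; linear_combination g2 - g0 + cyc 3 * z12 * hab
  · rw [bd_12, y012, y123]; linear_combination -e12 + cyc 2 * z12 * hab
  · rw [bd_13, y013, y123]; linear_combination g0 - g2 - g3 - cyc 3 * z12 * hab
  · rw [bd_23, y023, y123]; linear_combination -e23

/-- The coefficients of the fundamental cycle in degree three. -/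
noncomputable def vcoef (σ : Finset (Fin 4)) : R :=
  if σ = {0, 1, 2} then -cyc 4
  else if σ = {0, 1, 3} then cyc 2 * cyc 3 * cyc 4 * cyc 6 * cyc 10
  else if σ = {0, 2, 3} then -(cyc 2 * cyc 4 * cyc 5 * cyc 6 * cyc 10)
  else cyc 2 * cyc 5 * cyc 6 * cyc 10

lemma exact_three (x : Finset (Fin 4) → R) (h : ∀ σ : Finset (Fin 4), σ.card = 2 → bd x σ = 0) :
    ∃ t, ∀ σ : Finset (Fin 4), σ.card = 3 → t * vcoef σ = x σ := by
  have h01 := h {0, 1} rfl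
  have h12 := h {1, 2} rfl
  have h23 := h {2, 3} rfl
  rw [bd_01] at h01
  rw [bd_12] at h12
  rw [bd_23] at h23
  have hA := cyc_ne_zero 2
  obtain ⟨a, b, hab⟩ := cyc_bezout
  have g01 : cyc 2 * cyc 3 * cyc 6 * cyc 10 * x {0, 1, 2} + x {0, 1, 3} = 0 := by
    apply mul_left_cancel₀ hA
    linear_combination h01
  have g12 : cyc 2 * cyc 5 * cyc 6 * cyc 10 * x {0, 1, 2} + cyc 4 * x {1, 2, 3} = 0 := by
    apply mul_left_cancel₀ hA
    linear_combination h12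
  have g23 : x {0, 2, 3} + cyc 4 * x {1, 2, 3} = 0 := by
    apply mul_left_cancel₀ hA
    linear_combination h23
  have v012 : vcoef {0, 1, 2} = -cyc 4 := rfl
  have v013 : vcoef {0, 1, 3} = cyc 2 * cyc 3 * cyc 4 * cyc 6 * cyc 10 := rfl
  have v023 : vcoef {0, 2, 3} = -(cyc 2 * cyc 4 * cyc 5 * cyc 6 * cyc 10) := rfl
  have v123 : vcoef {1, 2, 3} = cyc 2 * cyc 5 * cyc 6 * cyc 10 := rfl
  have k012 : (b * x {1, 2, 3} - a * x {0, 1, 2}) * -cyc 4 = x {0, 1, 2} := by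
    linear_combination x {0, 1, 2} * hab - b * g12
  have k123 : (b * x {1, 2, 3} - a * x {0, 1, 2}) * (cyc 2 * cyc 5 * cyc 6 * cyc 10) =
      x {1, 2, 3} := by
    linear_combination x {1, 2, 3} * hab - a * g12
  refine ⟨b * x {1, 2, 3} - a * x {0, 1, 2}, fun σ hσ => ?_⟩
  rcases eq_of_card_three σ hσ with rfl | rfl | rfl | rfl
  · rw [v012, k012]
  · rw [v013]; linear_combination -(cyc 2 * cyc 3 * cyc 6 * cyc 10) * k012 - g01
  · rw [v023]; linear_combination -cyc 4 * k123 - g23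
  · rw [v123, k123]

/-- The product of the cyclotomic polynomials appearing in the third homology. -/
noncomputable def topCoef : R := cyc 2 * (cyc 3 * (cyc 4 * (cyc 5 * (cyc 6 * (cyc 10 * (cyc 12 *
  (cyc 15 * (cyc 20 * cyc 30))))))))

lemma bd_vcoef : ∀ σ : Finset (Fin 4), σ.card = 2 → bd vcoef σ = 0 := by
  have v012 : vcoef {0, 1, 2} = -cyc 4 := rfl
  have v013 : vcoef {0, 1, 3} = cyc 2 * cyc 3 * cyc 4 * cyc 6 * cyc 10 := rfl
  have v023 : vcoef {0, 2, 3} = -(cyc 2 * cyc 4 * cyc 5 * cyc 6 * cyc 10) := rfl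
  have v123 : vcoef {1, 2, 3} = cyc 2 * cyc 5 * cyc 6 * cyc 10 := rfl
  intro σ hσ
  rcases eq_of_card_two σ hσ with rfl | rfl | rfl | rfl | rfl | rfl
  · rw [bd_01, v012, v013]; ring
  · rw [bd_02, v012, v023]; ring
  · rw [bd_03, v013, v023]; ring
  · rw [bd_12, v012, v123]; ring
  · rw [bd_13, v013, v123]; ring
  · rw [bd_23, v023, v123]; ring

lemma bd_triple (y : Finset (Fin 4) → R) (σ : Finset (Fin 4)) (hσ : σ.card = 3) :
    bd y σ = y {0, 1, 2, 3} * topCoef * vcoef σ := by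
  have v012 : vcoef {0, 1, 2} = -cyc 4 := rfl
  have v013 : vcoef {0, 1, 3} = cyc 2 * cyc 3 * cyc 4 * cyc 6 * cyc 10 := rfl
  have v023 : vcoef {0, 2, 3} = -(cyc 2 * cyc 4 * cyc 5 * cyc 6 * cyc 10) := rfl
  have v123 : vcoef {1, 2, 3} = cyc 2 * cyc 5 * cyc 6 * cyc 10 := rfl
  rcases eq_of_card_three σ hσ with rfl | rfl | rfl | rfl
  · rw [bd_012, v012, topCoef]; ring
  · rw [bd_013, v013, topCoef]; ring
  · rw [bd_023, v023, topCoef]; ring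
  · rw [bd_123, v123, topCoef]; ring

/-! ### Homology -/

/-- The quotient by a product of two coprime elements. -/
lemma quotient_mul_equiv {a b : R} (h : IsCoprime a b) :
    Nonempty ((R ⧸ Ideal.span {a * b}) ≃ₗ[R] (R ⧸ Ideal.span {a}) × (R ⧸ Ideal.span {b})) := by
  let f : R →ₗ[R] (R ⧸ Ideal.span {a}) × (R ⧸ Ideal.span {b}) :=
    (Ideal.span {a}).mkQ.prod (Ideal.span {b}).mkQ
  have hker : LinearMap.ker f = Ideal.span {a * b} := by
    ext x
    rw [LinearMap.ker_prod, Submodule.ker_mkQ, Submodule.ker_mkQ, Submodule.mem_inf,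
      Ideal.mem_span_singleton, Ideal.mem_span_singleton, Ideal.mem_span_singleton]
    exact ⟨fun hx => h.mul_dvd hx.1 hx.2,
      fun hx => ⟨dvd_of_mul_right_dvd hx, dvd_of_mul_left_dvd hx⟩⟩
  have hsurj : Function.Surjective f := by
    rintro ⟨x, y⟩
    obtain ⟨x, rfl⟩ := Submodule.mkQ_surjective _ x
    obtain ⟨y, rfl⟩ := Submodule.mkQ_surjective _ y
    obtain ⟨u, v, huv⟩ := h
    refine ⟨x * (v * b) + y * (u * a), Prod.ext ?_ ?_⟩
    · refine (Submodule.Quotient.eq _).2 (Ideal.mem_span_singleton.2 ⟨(y - x) * u, ?_⟩)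
      linear_combination x * huv
    · refine (Submodule.Quotient.eq _).2 (Ideal.mem_span_singleton.2 ⟨(x - y) * v, ?_⟩)
      linear_combination y * huv
  exact ⟨(Submodule.quotEquivOfEq _ _ hker.symm).trans (f.quotKerEquivOfSurjective hsurj)⟩

lemma quotient_cyc_mul_equiv {d : ℕ} {b : R} {N : Type*} [AddCommGroup N] [Module R N]
    (h : IsCoprime (cyc d) b) (e : Nonempty ((R ⧸ Ideal.span {b}) ≃ₗ[R] N)) :
    Nonempty ((R ⧸ Ideal.span {cyc d * b}) ≃ₗ[R] CycQuot d × N) := by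
  obtain ⟨f⟩ := quotient_mul_equiv h
  obtain ⟨e⟩ := e
  exact ⟨f.trans ((LinearEquiv.refl R _).prodCongr e)⟩

lemma isCoprime_cyc {m n : ℕ} (h : m ≠ n) : IsCoprime (cyc m) (cyc n) :=
  (cyclotomic.isCoprime_rat h).map (toLaurent (R := ℚ))

lemma quotient_topCoef_equiv : Nonempty ((R ⧸ Ideal.span {topCoef}) ≃ₗ[R]
    (CycQuot 2 × CycQuot 3 × CycQuot 4 × CycQuot 5 × CycQuot 6 × CycQuot 10 × CycQuot 12 ×
      CycQuot 15 × CycQuot 20 × CycQuot 30)) := by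
  unfold topCoef
  iterate 9
    refine quotient_cyc_mul_equiv ?_ ?_
    · try simp only [IsCoprime.mul_right_iff]
      repeat' apply And.intro
      all_goals exact isCoprime_cyc (by norm_num)
  exact ⟨LinearEquiv.refl R _⟩

section Homology

variable {W : Type*} [Group W] {Mat : CoxeterMatrix (Fin 4)} (cs : CoxeterSystem Mat W)
  (hM : ∀ i j, Mat i j = coxEntry i j)

lemma exists_extension {k : ℕ} (x : KW cs k → R) :
    ∃ y : Finset (Fin 4) → R, x = fun σ => y σ.1 := by
  classical
  refine ⟨fun σ => if h : σ.card = k ∧ (parabolic cs σ : Set W).Finite then x ⟨σ, h⟩ else 0, ?_⟩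
  funext σ
  simp [σ.2.1, σ.2.2]

include hM in
lemma bdry_eq_zero_iff {k : ℕ} (y : Finset (Fin 4) → R) :
    bdry cs k (fun σ => y σ.1) = 0 ↔ ∀ σ : Finset (Fin 4), σ.card = k → bd y σ = 0 := by
  constructor
  · intro h σ hσ
    rw [← bdry_apply cs hM k y ⟨σ, hσ, finite_parabolic cs hM σ⟩, h]
    rfl
  · intro h
    funext σ
    rw [bdry_apply cs hM, h σ.1 σ.2.1]
    rfl

include hM in
lemma subsingleton_homology (k : ℕ)
    (h : ∀ y : Finset (Fin 4) → R, (∀ σ : Finset (Fin 4), σ.card = k → bd y σ = 0) →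
      ∃ z, ∀ σ : Finset (Fin 4), σ.card = k + 1 → bd z σ = y σ) :
    Subsingleton (Hgy cs (k + 1)) := by
  rw [Submodule.Quotient.subsingleton_iff, eq_top_iff]
  rintro ⟨x, hx⟩ -
  obtain ⟨y, rfl⟩ := exists_extension cs x
  obtain ⟨z, hz⟩ := h y ((bdry_eq_zero_iff cs hM y).1 hx)
  refine ⟨fun σ => z σ.1, ?_⟩
  funext σ
  rw [bdry_apply cs hM, hz σ.1 σ.2.1]
  rfl

/-- If the cycles are generated by one element `v` and the boundaries are its multiples by the
ideal generated by `c`, the homology is `R/(c)`. -/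
lemma homology_equiv_of_generator (k : ℕ) (v : cycles cs k) (c : R)
    (hv : ∀ x : cycles cs k, ∃ t : R, t • v = x)
    (hc : ∀ t : R, (t • v : KW cs k → R) ∈ LinearMap.range (bdry cs k) ↔ c ∣ t) :
    Nonempty (Hgy cs k ≃ₗ[R] R ⧸ Ideal.span {c}) := by
  let f : R →ₗ[R] Hgy cs k := (Submodule.mkQ _).comp (LinearMap.toSpanSingleton R _ v)
  have hf : Function.Surjective f := (Submodule.mkQ_surjective _).comp hv
  have hker : LinearMap.ker f = Ideal.span {c} := by
    ext t
    rw [LinearMap.ker_comp, Submodule.ker_mkQ, Submodule.mem_comap, Submodule.mem_comap,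
      Ideal.mem_span_singleton, ← hc]
    rfl
  exact ⟨((Submodule.quotEquivOfEq _ _ hker.symm).trans (f.quotKerEquivOfSurjective hf)).symm⟩

include hM in
lemma homology_zero : Nonempty (Hgy cs 0 ≃ₗ[R] CycQuot 2) := by
  refine homology_equiv_of_generator cs 0 ⟨fun _ => 1, trivial⟩ (cyc 2) ?_ ?_
  · rintro ⟨x, -⟩
    obtain ⟨y, rfl⟩ := exists_extension cs x
    refine ⟨y ∅, Subtype.ext (funext fun σ => ?_)⟩
    simp [eq_empty_of_card σ.1 σ.2.1]
  · intro t
    constructor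
    · rintro ⟨z, hz⟩
      obtain ⟨y, rfl⟩ := exists_extension cs z
      have h := congrFun hz ⟨∅, rfl, finite_parabolic cs hM ∅⟩
      rw [bdry_apply cs hM, bd_empty] at h
      simp only [Pi.smul_apply, smul_eq_mul, mul_one] at h
      exact ⟨y {0} + y {1} + y {2} + y {3}, by linear_combination -h⟩
    · rintro ⟨r, rfl⟩
      refine ⟨fun σ => if σ.1 = {0} then r else 0, funext fun σ => ?_⟩
      rw [bdry_apply cs hM 0 (fun σ => if σ = {0} then r else 0), eq_empty_of_card σ.1 σ.2.1,
        bd_empty]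
      simp

include hM in
lemma homology_three : Nonempty (Hgy cs 3 ≃ₗ[R] R ⧸ Ideal.span {topCoef}) := by
  refine homology_equiv_of_generator cs 3
    ⟨fun σ => vcoef σ.1, (bdry_eq_zero_iff cs hM vcoef).2 bd_vcoef⟩ topCoef ?_ ?_
  · rintro ⟨x, hx⟩
    obtain ⟨y, rfl⟩ := exists_extension cs x
    obtain ⟨t, ht⟩ := exact_three y ((bdry_eq_zero_iff cs hM y).1 hx)
    exact ⟨t, Subtype.ext (funext fun σ => ht σ.1 σ.2.1)⟩
  · intro t
    constructor
    · rintro ⟨z, hz⟩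
      obtain ⟨y, rfl⟩ := exists_extension cs z
      have h := congrFun hz ⟨{0, 1, 2}, rfl, finite_parabolic cs hM _⟩
      rw [bdry_apply cs hM, bd_triple _ _ rfl] at h
      have h4 : vcoef {0, 1, 2} ≠ 0 := neg_ne_zero.2 (cyc_ne_zero 4)
      have h5 : y {0, 1, 2, 3} * topCoef = t := mul_right_cancel₀ h4 h
      exact ⟨y {0, 1, 2, 3}, by rw [← h5, mul_comm]⟩
    · rintro ⟨r, rfl⟩
      refine ⟨fun _ => r, funext fun σ => ?_⟩
      rw [bdry_apply cs hM 3 (fun _ => r), bd_triple _ _ σ.2.1]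
      simp only [Pi.smul_apply, smul_eq_mul]
      ring

include hM in
lemma subsingleton_homology_of_three_le (k : ℕ) (hk : 3 ≤ k) : Subsingleton (Hgy cs (k + 1)) := by
  refine subsingleton_homology cs hM k fun y hy => ⟨0, fun σ hσ => ?_⟩
  have hcard : σ.card ≤ 4 := σ.card_le_univ
  obtain rfl : k = 3 := by omega
  have h1 := hy {0, 1, 2} rfl
  rw [bd_triple _ _ rfl] at h1
  have h4 : vcoef {0, 1, 2} ≠ 0 := neg_ne_zero.2 (cyc_ne_zero 4)
  have h5 : topCoef ≠ 0 := by simp [topCoef, cyc_ne_zero]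
  have h6 : y {0, 1, 2, 3} = 0 := by simpa [h4, h5] using h1
  rw [eq_of_card_four σ hσ, h6, bd]
  exact Finset.sum_eq_zero fun s _ => mul_zero _

end Homology

end H4

/-- Homology of the weighted complex for the Coxeter system of type `H₄` (generators indexed by `0,1,2,3` corresponding to `1,2,3,4`). -/
theorem homology_H4 {W : Type*} [Group W] {Mat : CoxeterMatrix (Fin 4)}
    (cs : CoxeterSystem Mat W)
    (h12 : Mat.M 0 1 = 5) (h23 : Mat.M 1 2 = 3) (h34 : Mat.M 2 3 = 3)
    (h13 : Mat.M 0 2 = 2) (h14 : Mat.M 0 3 = 2) (h24 : Mat.M 1 3 = 2) :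
    Nonempty (Hgy cs 0 ≃ₗ[R] (CycQuot 2)) ∧
    Subsingleton (Hgy cs 1) ∧
    Subsingleton (Hgy cs 2) ∧
    Nonempty (Hgy cs 3 ≃ₗ[R] (CycQuot 2 × CycQuot 3 × CycQuot 4 × CycQuot 5 × CycQuot 6 × CycQuot 10 × CycQuot 12 × CycQuot 15 × CycQuot 20 × CycQuot 30)) ∧
    (∀ k, 4 ≤ k → Subsingleton (Hgy cs k)) := by
  have hM : ∀ i j, Mat i j = H4.coxEntry i j := by
    have hs := Mat.symmetric
    have hd := Mat.diagonal
    intro i j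
    fin_cases i <;> fin_cases j <;> first
      | exact hd _
      | assumption
      | exact (hs _ _).trans ‹_›
  refine ⟨H4.homology_zero cs hM,
    H4.subsingleton_homology cs hM 0 fun y hy => H4.exact_one y (hy ∅ rfl),
    H4.subsingleton_homology cs hM 1 H4.exact_two, ?_, fun k hk => ?_⟩
  · obtain ⟨e⟩ := H4.homology_three cs hM
    obtain ⟨f⟩ := H4.quotient_topCoef_equiv
    exact ⟨e.trans f⟩
  · obtain ⟨k, rfl⟩ := Nat.exists_eq_add_of_le' (show 1 ≤ k by omega)
    exact H4.subsingleton_homology_of_three_le cs hM k (by omega)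
end
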